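/- arXiv:1011.2050 — 13 statements merged into one kernel-verified Lean document; each statement's English description precedes it below -/
import Mathlib

section
/- Suppose β₂ ≠ 0 and α₁β₂ ≠ α₂β₁. Then a point (x*, y*) ∈ ℝ² is an equilibrium of the system if and only if there is a real eigenvalue λ of the associated matrix A (equivalently, a real root λ of λ³ − β₁λ² − α₂λ + (β₁α₂ − β₂α₁)) such that (x*, y*) = ((λ² − α₂)/β₂, λ). In particular, every such λ is nonzero and the system has exactly as many equilibria as A has distinct real eigenvalues. -/
open Filter Topology

/-- `(x, y)` is a complete solution of the planar rational system
`x_{n+1} = (α₁ + β₁ xₙ)/yₙ`, `y_{n+1} = (α₂ + β₂ xₙ)/yₙ`. -/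
def IsSol (a1 b1 a2 b2 : ℝ) (x y : ℕ → ℝ) : Prop :=
  (∀ n, y n ≠ 0) ∧
  (∀ n, x (n + 1) = (a1 + b1 * x n) / y n) ∧
  (∀ n, y (n + 1) = (a2 + b2 * x n) / y n)

/-- `p` is an equilibrium of the system. -/
def IsEquilib (a1 b1 a2 b2 : ℝ) (p : ℝ × ℝ) : Prop :=
  p.2 ≠ 0 ∧ p.1 = (a1 + b1 * p.1) / p.2 ∧ p.2 = (a2 + b2 * p.1) / p.2

theorem ne_zero_of_cubic_root {a1 b1 a2 b2 l : ℝ} (hd : a1 * b2 ≠ a2 * b1)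
    (hl : l ^ 3 - b1 * l ^ 2 - a2 * l + (b1 * a2 - b2 * a1) = 0) : l ≠ 0 := by
  rintro rfl
  exact hd (by linarith)

theorem isEquilib_iff_exists_cubic_root {a1 b1 a2 b2 : ℝ} (hb2 : b2 ≠ 0)
    (hd : a1 * b2 ≠ a2 * b1) (p : ℝ × ℝ) :
    IsEquilib a1 b1 a2 b2 p ↔
      ∃ l : ℝ, l ^ 3 - b1 * l ^ 2 - a2 * l + (b1 * a2 - b2 * a1) = 0 ∧
        p = ((l ^ 2 - a2) / b2, l) := by
  obtain ⟨x, y⟩ := p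
  constructor
  · rintro ⟨hy, hx, hyy⟩
    simp only at hy hx hyy
    rw [eq_div_iff hy] at hx hyy
    refine ⟨y, by linear_combination b2 * hx + (y - b1) * hyy, Prod.ext ?_ rfl⟩
    simp only
    rw [eq_div_iff hb2]
    linear_combination -hyy
  · rintro ⟨l, hl, h⟩
    obtain ⟨rfl, rfl⟩ := Prod.mk.inj h
    have hy := ne_zero_of_cubic_root hd hl
    refine ⟨hy, ?_, ?_⟩ <;> simp only <;> rw [eq_div_iff hy] <;> field_simp
    · linear_combination hl
    · ring

/-- for `β₂ ≠ 0` and `α₁β₂ ≠ α₂β₁`, a point is an equilibrium iff it is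
`((λ² − α₂)/β₂, λ)` for a real root `λ` of the characteristic cubic; every such `λ` is
nonzero, and `λ ↦ ((λ² − α₂)/β₂, λ)` is a bijection from the set of real eigenvalues onto
the set of equilibria. -/
theorem stmt0 (a1 b1 a2 b2 : ℝ) (hb2 : b2 ≠ 0) (hd : a1 * b2 ≠ a2 * b1) :
    (∀ p : ℝ × ℝ, IsEquilib a1 b1 a2 b2 p ↔
      ∃ l : ℝ, l ^ 3 - b1 * l ^ 2 - a2 * l + (b1 * a2 - b2 * a1) = 0 ∧
        p = ((l ^ 2 - a2) / b2, l)) ∧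
    (∀ l : ℝ, l ^ 3 - b1 * l ^ 2 - a2 * l + (b1 * a2 - b2 * a1) = 0 → l ≠ 0) ∧
    Set.BijOn (fun l : ℝ => ((l ^ 2 - a2) / b2, l))
      {l : ℝ | l ^ 3 - b1 * l ^ 2 - a2 * l + (b1 * a2 - b2 * a1) = 0}
      {p : ℝ × ℝ | IsEquilib a1 b1 a2 b2 p} := by
  have hiff := isEquilib_iff_exists_cubic_root hb2 hd
  refine ⟨hiff, fun l hl => ne_zero_of_cubic_root hd hl, ?_, ?_, ?_⟩
  · exact fun l hl => (hiff _).2 ⟨l, hl, rfl⟩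
  · exact fun l _ m _ h => (Prod.mk.inj h).2
  · intro p hp
    obtain ⟨l, hl, rfl⟩ := (hiff p).1 hp
    exact ⟨l, hl, rfl⟩
end

section
/- Suppose β₂ = 0 and α₁β₂ ≠ α₂β₁ (equivalently β₁α₂ ≠ 0). Then: (a) if α₂ < 0, the system has no equilibria; (b) if 0 < α₂ and α₂ ≠ β₁², the equilibria are exactly the two points (α₁/(√α₂ − β₁), √α₂) and (−α₁/(√α₂ + β₁), −√α₂); (c) if α₂ = β₁² and α₁ ≠ 0, the unique equilibrium is (−α₁/(2β₁), −β₁); (d) if α₂ = β₁² and α₁ = 0, the equilibria are exactly the isolated point (0, −β₁) together with every point (x, β₁) with x ∈ ℝ. -/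
open Filter Topology

/-- Clearing denominators in the equilibrium equations when `β₂ = 0`. -/
theorem isEquilib_zero_iff {a1 b1 a2 x y : ℝ} (ha2 : a2 ≠ 0) :
    IsEquilib a1 b1 a2 0 (x, y) ↔ x * (y - b1) = a1 ∧ y ^ 2 = a2 := by
  have key (hy : y ≠ 0) : IsEquilib a1 b1 a2 0 (x, y) ↔ x * (y - b1) = a1 ∧ y ^ 2 = a2 := by
    simp only [IsEquilib, eq_div_iff hy, ne_eq, hy, not_false_eq_true, true_and]
    constructor <;> rintro ⟨h1, h2⟩ <;> constructor <;> linarith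
  refine ⟨fun h => (key h.1).1 h, fun h => (key ?_).2 h⟩
  rintro rfl
  exact ha2 (by simpa using h.2.symm)

/-- description of the equilibria of the system when `β₂ = 0` and
`β₁α₂ ≠ 0`. -/
theorem stmt1 (a1 b1 a2 b2 : ℝ) (hb2 : b2 = 0) (hba : b1 * a2 ≠ 0) :
    (a2 < 0 → ∀ p : ℝ × ℝ, ¬ IsEquilib a1 b1 a2 b2 p) ∧
    (0 < a2 → a2 ≠ b1 ^ 2 → ∀ p : ℝ × ℝ, IsEquilib a1 b1 a2 b2 p ↔
      p = (a1 / (Real.sqrt a2 - b1), Real.sqrt a2) ∨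
      p = (-a1 / (Real.sqrt a2 + b1), -Real.sqrt a2)) ∧
    (a2 = b1 ^ 2 → a1 ≠ 0 → ∀ p : ℝ × ℝ, IsEquilib a1 b1 a2 b2 p ↔
      p = (-a1 / (2 * b1), -b1)) ∧
    (a2 = b1 ^ 2 → a1 = 0 → ∀ p : ℝ × ℝ, IsEquilib a1 b1 a2 b2 p ↔
      p = (0, -b1) ∨ p.2 = b1) := by
  subst hb2
  have hb1 : b1 ≠ 0 := left_ne_zero_of_mul hba
  have ha2 : a2 ≠ 0 := right_ne_zero_of_mul hba
  refine ⟨?_, ?_, ?_, ?_⟩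
  · rintro hneg ⟨x, y⟩ h
    have := ((isEquilib_zero_iff ha2).1 h).2
    nlinarith [sq_nonneg y]
  · rintro hpos hne ⟨x, y⟩
    have hs : √a2 ^ 2 = a2 := Real.sq_sqrt hpos.le
    have hm : √a2 - b1 ≠ 0 := fun h => hne (by rw [← hs, sub_eq_zero.1 h])
    have hp : √a2 + b1 ≠ 0 := fun h => hne (by rw [← hs, eq_neg_of_add_eq_zero_left h, neg_sq])
    rw [isEquilib_zero_iff ha2, Prod.mk.injEq, Prod.mk.injEq, eq_div_iff hm, eq_div_iff hp]
    constructor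
    · rintro ⟨h1, h2⟩
      rcases sq_eq_sq_iff_eq_or_eq_neg.1 (h2.trans hs.symm) with rfl | rfl
      · exact Or.inl ⟨h1, rfl⟩
      · exact Or.inr ⟨by linarith, rfl⟩
    · rintro (⟨h, rfl⟩ | ⟨h, rfl⟩)
      · exact ⟨h, hs⟩
      · exact ⟨by linarith, by rw [neg_sq, hs]⟩
  · rintro rfl ha1 ⟨x, y⟩
    rw [isEquilib_zero_iff ha2, Prod.mk.injEq, eq_div_iff (mul_ne_zero two_ne_zero hb1)]
    constructor
    · rintro ⟨h1, h2⟩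
      rcases sq_eq_sq_iff_eq_or_eq_neg.1 h2 with rfl | rfl
      · exact absurd (by simpa using h1.symm) ha1
      · exact ⟨by linarith, rfl⟩
    · rintro ⟨h, rfl⟩
      exact ⟨by linarith, neg_sq b1⟩
  · rintro rfl rfl ⟨x, y⟩
    rw [isEquilib_zero_iff ha2, Prod.mk.injEq]
    constructor
    · rintro ⟨h1, h2⟩
      rcases sq_eq_sq_iff_eq_or_eq_neg.1 h2 with rfl | rfl
      · exact Or.inr rfl
      · refine Or.inl ⟨?_, rfl⟩
        have : x * b1 = 0 := by linarith
        exact (mul_eq_zero.1 this).resolve_right hb1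
    · rintro (⟨rfl, rfl⟩ | rfl) <;> simp
end

section
/- Suppose α₁β₂ ≠ α₂β₁. Then the system admits a complete solution of prime period 2 if and only if α₁β₂ = 0. Moreover, if α₁ = 0, every complete solution with initial condition (0, y₀) with y₀² ≠ α₂ is of prime period 2, and if α₁ ≠ 0 and β₂ = 0, the solution with initial condition (0, −β₁) is of prime period 2. -/
open Filter Topology

/-- The complete solution `(x, y)` has prime period 2. -/
def PrimePeriod2 (x y : ℕ → ℝ) : Prop :=
  (∀ n, x (n + 2) = x n ∧ y (n + 2) = y n) ∧
  ¬(∀ n, x (n + 1) = x n ∧ y (n + 1) = y n)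

/-- A complete solution that returns to its initial state after two steps repeats with period 2. -/
theorem IsSol.periodic_two {a1 b1 a2 b2 : ℝ} {x y : ℕ → ℝ} (h : IsSol a1 b1 a2 b2 x y)
    (hx : x 2 = x 0) (hy : y 2 = y 0) (n : ℕ) : x (n + 2) = x n ∧ y (n + 2) = y n := by
  obtain ⟨-, h1, h2⟩ := h
  induction n with
  | zero => exact ⟨hx, hy⟩
  | succ k ih =>
    rw [show k + 1 + 2 = k + 2 + 1 by ring, h1 (k + 2), h2 (k + 2), h1 k, h2 k, ih.1, ih.2]
    exact ⟨rfl, rfl⟩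

/-- Two states mapped to each other by the system give rise to a complete solution. -/
theorem exists_isSol_of_swap {a1 b1 a2 b2 p q r s : ℝ} (hq : q ≠ 0) (hs : s ≠ 0)
    (hr : r = (a1 + b1 * p) / q) (hs' : s = (a2 + b2 * p) / q)
    (hp : p = (a1 + b1 * r) / s) (hq' : q = (a2 + b2 * r) / s) :
    ∃ x y : ℕ → ℝ, IsSol a1 b1 a2 b2 x y ∧ x 0 = p ∧ y 0 = q := by
  refine ⟨fun n => if Even n then p else r, fun n => if Even n then q else s,
    ⟨fun n => ?_, fun n => ?_, fun n => ?_⟩, by simp, by simp⟩ <;>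
  by_cases hn : Even n <;> simp only [Nat.even_add_one, hn, not_true, not_false_eq_true, if_true,
    if_false] <;> assumption

/-- If `α₁ = 0`, complete solutions starting on the `y`-axis off the equilibria have prime
period 2. -/
theorem primePeriod2_of_a1_eq_zero {b1 a2 b2 : ℝ} {x y : ℕ → ℝ} (h : IsSol 0 b1 a2 b2 x y)
    (hx : x 0 = 0) (hy : y 0 ^ 2 ≠ a2) : PrimePeriod2 x y := by
  have hy0 := h.1 0
  have hy1 := h.1 1
  have x1 : x 1 = 0 := by simpa [hx] using h.2.1 0
  have x2 : x 2 = 0 := by simpa [x1] using h.2.1 1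
  have y1 : y 1 = a2 / y 0 := by simpa [hx] using h.2.2 0
  have y2 : y 2 = a2 / y 1 := by simpa [x1] using h.2.2 1
  have ha2 : a2 ≠ 0 := by
    rintro rfl
    simp [y1] at hy1
  refine ⟨h.periodic_two (x2.trans hx.symm) ?_, fun hc => hy ?_⟩
  · rw [y2, y1]
    field_simp
  · have h10 : y 1 = y 0 := (hc 0).2
    rw [y1, div_eq_iff hy0] at h10
    rw [h10, sq]

/-- If `β₂ = 0` and `α₁ ≠ 0`, the complete solution starting at `(0, -β₁)` has prime period 2. -/
theorem primePeriod2_of_b2_eq_zero {a1 b1 a2 : ℝ} {x y : ℕ → ℝ} (h : IsSol a1 b1 a2 0 x y)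
    (ha1 : a1 ≠ 0) (hx : x 0 = 0) (hy : y 0 = -b1) : PrimePeriod2 x y := by
  have hb1 : b1 ≠ 0 := by
    have := h.1 0
    rwa [hy, neg_ne_zero] at this
  have hy1 := h.1 1
  have x1 : x 1 = a1 / -b1 := by simpa [hx, hy] using h.2.1 0
  have y1 : y 1 = a2 / -b1 := by simpa [hy] using h.2.2 0
  have x2 : x 2 = (a1 + b1 * x 1) / y 1 := h.2.1 1
  have y2 : y 2 = a2 / y 1 := by simpa using h.2.2 1
  have ha2 : a2 ≠ 0 := by
    rintro rfl
    simp [y1] at hy1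
  refine ⟨h.periodic_two ?_ ?_, fun hc => ?_⟩
  · rw [x2, x1, hx, mul_div_assoc', div_neg, mul_div_cancel_left₀ a1 hb1, add_neg_cancel,
      zero_div]
  · rw [y2, y1, hy]
    field_simp
  · have h10 : x 1 = x 0 := (hc 0).1
    rw [x1, hx] at h10
    exact div_ne_zero ha1 (neg_ne_zero.2 hb1) h10

/-- A complete solution of prime period 2 forces `α₁β₂ = 0`. -/
theorem IsSol.mul_eq_zero_of_primePeriod2 {a1 b1 a2 b2 : ℝ} {x y : ℕ → ℝ}
    (h : IsSol a1 b1 a2 b2 x y) (hp : PrimePeriod2 x y) : a1 * b2 = 0 := by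
  obtain ⟨hy, h1, h2⟩ := h
  obtain ⟨hper, hne⟩ := hp
  by_contra hab
  obtain ⟨ha1, hb2⟩ := mul_ne_zero_iff.1 hab
  refine hne fun n => ?_
  have e1 := (eq_div_iff (hy n)).1 (h1 n)
  have e2 := (eq_div_iff (hy n)).1 (h2 n)
  have e3 := (eq_div_iff (hy (n + 1))).1 (h1 (n + 1))
  have e4 := (eq_div_iff (hy (n + 1))).1 (h2 (n + 1))
  rw [show n + 1 + 1 = n + 2 from rfl] at e3 e4
  rw [(hper n).1] at e3
  rw [(hper n).2] at e4
  have hx : x (n + 1) = x n := mul_left_cancel₀ hb2 (by linarith)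
  rw [hx] at e1 e3
  have hx0 : x n ≠ 0 := by
    intro h0
    rw [h0] at e1
    exact ha1 (by linarith)
  exact ⟨hx, mul_left_cancel₀ hx0 (e3.trans e1.symm)⟩

/-- for `α₁β₂ ≠ α₂β₁`, the system admits a complete solution of prime period 2
iff `α₁β₂ = 0`; if `α₁ = 0`, every complete solution starting at `(0, y₀)` with `y₀² ≠ α₂`
has prime period 2, and if `α₁ ≠ 0` and `β₂ = 0`, the solution starting at `(0, −β₁)` has
prime period 2. -/
theorem stmt2 (a1 b1 a2 b2 : ℝ) (hd : a1 * b2 ≠ a2 * b1) :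
    ((∃ x y : ℕ → ℝ, IsSol a1 b1 a2 b2 x y ∧ PrimePeriod2 x y) ↔ a1 * b2 = 0) ∧
    (a1 = 0 → ∀ x y : ℕ → ℝ, IsSol a1 b1 a2 b2 x y → x 0 = 0 → (y 0) ^ 2 ≠ a2 →
      PrimePeriod2 x y) ∧
    (a1 ≠ 0 → b2 = 0 → ∀ x y : ℕ → ℝ, IsSol a1 b1 a2 b2 x y → x 0 = 0 → y 0 = -b1 →
      PrimePeriod2 x y) := by
  refine ⟨⟨fun ⟨x, y, h, hp⟩ => h.mul_eq_zero_of_primePeriod2 hp, fun h0 => ?_⟩, ?_, ?_⟩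
  · have hab : a2 * b1 ≠ 0 := fun h => hd (h0.trans h.symm)
    obtain ⟨ha2, hb1⟩ := mul_ne_zero_iff.1 hab
    by_cases ha1 : a1 = 0
    · subst ha1
      have hpos : 0 < |a2| + 1 := by positivity
      obtain ⟨x, y, h, hx, hy⟩ := exists_isSol_of_swap (a1 := 0) (b1 := b1) (a2 := a2)
        (b2 := b2) (p := 0) (q := |a2| + 1) (r := 0) (s := a2 / (|a2| + 1)) hpos.ne'
        (div_ne_zero ha2 hpos.ne') (by simp) (by simp) (by simp)
        (by rw [mul_zero, add_zero, div_div_cancel₀ ha2])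
      refine ⟨x, y, h, primePeriod2_of_a1_eq_zero h hx ?_⟩
      rw [hy]
      nlinarith [le_abs_self a2, abs_nonneg a2]
    · obtain rfl : b2 = 0 := (mul_eq_zero.1 h0).resolve_left ha1
      obtain ⟨x, y, h, hx, hy⟩ := exists_isSol_of_swap (a1 := a1) (b1 := b1) (a2 := a2)
        (b2 := 0) (p := 0) (q := -b1) (r := a1 / -b1) (s := a2 / -b1) (neg_ne_zero.2 hb1)
        (div_ne_zero ha2 (neg_ne_zero.2 hb1)) (by simp) (by simp)
        (by field_simp; simp) (by field_simp; simp)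
      exact ⟨x, y, h, primePeriod2_of_b2_eq_zero h ha1 hx hy⟩
  · rintro rfl x y h hx hy
    exact primePeriod2_of_a1_eq_zero h hx hy
  · rintro ha1 rfl x y h hx hy
    exact primePeriod2_of_b2_eq_zero h ha1 hx hy
end

section
/- Suppose α₁β₂ ≠ α₂β₁, let λ be a real eigenvalue of the associated matrix A, let λ₂ and λ₃ be the other two eigenvalues of A (counted with multiplicity, possibly complex), and let (x*, y*) be an equilibrium of the system with y* = λ. Then the Jacobian matrix DF(x*, y*) = [[β₁/y*, −x*/y*], [β₂/y*, −1]] of the map F(x, y) = ((α₁ + β₁x)/y, (α₂ + β₂x)/y) satisfies trace(DF(x*, y*)) = (β₁ − λ)/λ = (λ₂ + λ₃)/λ and det(DF(x*, y*)) = det(A)/λ³ = λ₂λ₃/λ²; consequently the eigenvalues of DF(x*, y*) are λ₂/λ and λ₃/λ. -/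
open Filter Topology

/-- Vieta's formulas for the sum and the product of the roots of a monic complex cubic. -/
lemma vieta_of_monic_cubic {p q r u v w : ℂ}
    (h : ∀ z : ℂ, z ^ 3 - p * z ^ 2 - q * z + r = (z - u) * (z - v) * (z - w)) :
    p = u + v + w ∧ r = -(u * v * w) :=
  ⟨by linear_combination h 0 - (h 1 + h (-1)) / 2, by linear_combination h 0⟩

/-- trace, determinant and eigenvalues of the Jacobian at an equilibrium
associated to the real eigenvalue `λ`, in terms of the other two eigenvalues `λ₂, λ₃`
of the associated matrix `A`. -/
theorem stmt3 (a1 b1 a2 b2 : ℝ) (hd : a1 * b2 ≠ a2 * b1)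
    (l : ℝ) (l2 l3 : ℂ)
    (hfact : ∀ z : ℂ, z ^ 3 - (b1 : ℂ) * z ^ 2 - (a2 : ℂ) * z + ((b1 * a2 - b2 * a1 : ℝ) : ℂ) =
      (z - (l : ℂ)) * (z - l2) * (z - l3))
    (xs ys : ℝ) (heq : IsEquilib a1 b1 a2 b2 (xs, ys)) (hys : ys = l) :
    let J : Matrix (Fin 2) (Fin 2) ℝ := !![b1 / ys, -xs / ys; b2 / ys, -1]
    let A : Matrix (Fin 3) (Fin 3) ℝ := !![b1, 0, a1; b2, 0, a2; 0, 1, 0]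
    J.trace = (b1 - l) / l ∧ (J.trace : ℂ) = (l2 + l3) / (l : ℂ) ∧
    J.det = A.det / l ^ 3 ∧ (J.det : ℂ) = l2 * l3 / (l : ℂ) ^ 2 ∧
    (∀ z : ℂ, z ^ 2 - (J.trace : ℂ) * z + (J.det : ℂ) =
      (z - l2 / (l : ℂ)) * (z - l3 / (l : ℂ))) := by
  obtain ⟨hy, hx1, hy1⟩ := heq
  subst hys
  dsimp only at hy hx1 hy1
  have hx : xs * ys = a1 + b1 * xs := (eq_div_iff hy).mp hx1
  have hy2 : ys * ys = a2 + b2 * xs := (eq_div_iff hy).mp hy1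
  obtain ⟨hsum, hprod⟩ := vieta_of_monic_cubic hfact
  have hyc : (ys : ℂ) ≠ 0 := by exact_mod_cast hy
  intro J A
  have htr : J.trace = (b1 - ys) / ys := by
    simp only [J, Matrix.trace_fin_two_of]
    field_simp
    ring
  have hA : A.det = -(b1 * a2 - b2 * a1) := by
    simp [A, Matrix.det_fin_three]
    ring
  have hdet : J.det = A.det / ys ^ 3 := by
    rw [hA]
    simp only [J, Matrix.det_fin_two_of]
    field_simp
    linear_combination b2 * hx - b1 * hy2
  have htrC : (J.trace : ℂ) = (l2 + l3) / (ys : ℂ) := by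
    rw [htr]
    push_cast
    rw [hsum]
    ring
  have hdetC : (J.det : ℂ) = l2 * l3 / (ys : ℂ) ^ 2 := by
    rw [hdet, hA, Complex.ofReal_div, Complex.ofReal_neg, hprod, Complex.ofReal_pow]
    field_simp
  refine ⟨htr, htrC, hdet, hdetC, fun z => ?_⟩
  rw [htrC, hdetC]
  field_simp
  ring
end

section
/- Suppose β₂ = 0, β₁α₂ ≠ 0 and α₂ ≠ β₁². Then for every initial condition (x₀, y₀) with y₀ ≠ 0 the system has a complete solution given by: y_n = y₀ for even n and y_n = α₂/y₀ for odd n; x₁ = (α₁ + β₁x₀)/y₀; and for n > 1, x_n = (β₁²/α₂)^{n/2} · [x₀ + (α₁(β₁ + y₀)/(β₁² − α₂)) · (1 − (α₂/β₁²)^{n/2})] if n is even, and x_n = α₁/y₀ + (β₁/y₀) · (β₁²/α₂)^{(n−1)/2} · [x₀ + (α₁(β₁ + y₀)/(β₁² − α₂)) · (1 − (α₂/β₁²)^{(n−1)/2})] if n is odd. -/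
open Filter Topology

/-- The even-indexed terms of the first coordinate satisfy a first-order linear recurrence. -/
theorem even_term_succ {a1 b1 a2 : ℝ} (hb1 : b1 ≠ 0) (h2 : a2 ≠ 0) (ha2 : a2 ≠ b1 ^ 2)
    (x0 y0 : ℝ) (m : ℕ) :
    (b1 ^ 2 / a2) ^ (m + 1) *
        (x0 + a1 * (b1 + y0) / (b1 ^ 2 - a2) * (1 - (a2 / b1 ^ 2) ^ (m + 1))) =
      (a1 * (b1 + y0) + b1 ^ 2 * ((b1 ^ 2 / a2) ^ m *
        (x0 + a1 * (b1 + y0) / (b1 ^ 2 - a2) * (1 - (a2 / b1 ^ 2) ^ m)))) / a2 := by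
  have hd : b1 ^ 2 - a2 ≠ 0 := sub_ne_zero.mpr ha2.symm
  have key (k : ℕ) : (b1 ^ 2 / a2) ^ k * (a2 / b1 ^ 2) ^ k = 1 := by
    rw [← mul_pow, div_mul_div_comm, mul_comm a2, div_self (by positivity), one_pow]
  have expand (k : ℕ) (c : ℝ) : (b1 ^ 2 / a2) ^ k * (x0 + c * (1 - (a2 / b1 ^ 2) ^ k)) =
      (b1 ^ 2 / a2) ^ k * (x0 + c) - c := by
    linear_combination (-c) * key k
  rw [expand, expand, pow_succ]
  generalize (b1 ^ 2 / a2) ^ m = r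
  field_simp
  ring

/-- explicit complete solution when `β₂ = 0`, `β₁α₂ ≠ 0` and `α₂ ≠ β₁²`.
(Here `n / 2` and `(n − 1) / 2` are the natural numbers `n/2` for even `n` and `(n−1)/2`
for odd `n`.) -/
theorem stmt7 (a1 b1 a2 b2 : ℝ) (hb2 : b2 = 0) (hba : b1 * a2 ≠ 0) (ha2 : a2 ≠ b1 ^ 2)
    (x0 y0 : ℝ) (hy0 : y0 ≠ 0) :
    ∃ x y : ℕ → ℝ, IsSol a1 b1 a2 b2 x y ∧ x 0 = x0 ∧ y 0 = y0 ∧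
      (∀ n : ℕ, Even n → y n = y0) ∧
      (∀ n : ℕ, Odd n → y n = a2 / y0) ∧
      x 1 = (a1 + b1 * x0) / y0 ∧
      (∀ n : ℕ, 1 < n → Even n →
        x n = (b1 ^ 2 / a2) ^ (n / 2) *
          (x0 + a1 * (b1 + y0) / (b1 ^ 2 - a2) * (1 - (a2 / b1 ^ 2) ^ (n / 2)))) ∧
      (∀ n : ℕ, 1 < n → Odd n →
        x n = a1 / y0 + b1 / y0 * (b1 ^ 2 / a2) ^ ((n - 1) / 2) *
          (x0 + a1 * (b1 + y0) / (b1 ^ 2 - a2) *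
            (1 - (a2 / b1 ^ 2) ^ ((n - 1) / 2)))) := by
  subst hb2
  obtain ⟨hb1, h2⟩ := mul_ne_zero_iff.mp hba
  let E : ℕ → ℝ := fun m => (b1 ^ 2 / a2) ^ m *
    (x0 + a1 * (b1 + y0) / (b1 ^ 2 - a2) * (1 - (a2 / b1 ^ 2) ^ m))
  have hE (m : ℕ) : E (m + 1) = (a1 * (b1 + y0) + b1 ^ 2 * E m) / a2 :=
    even_term_succ hb1 h2 ha2 x0 y0 m
  have hE0 : E 0 = x0 := by simp [E]
  refine ⟨fun n => if Even n then E (n / 2) else (a1 + b1 * E (n / 2)) / y0,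
    fun n => if Even n then y0 else a2 / y0, ⟨?_, ?_, ?_⟩, ?_, ?_, ?_, ?_, ?_, ?_, ?_⟩
  · intro n
    dsimp only
    split_ifs
    · exact hy0
    · exact div_ne_zero h2 hy0
  · intro n
    rcases Nat.even_or_odd n with h | h
    · have hn : (n + 1) / 2 = n / 2 := by grind
      simp [h, Nat.even_add_one, hn]
    · have hn : (n + 1) / 2 = n / 2 + 1 := by grind
      simp only [Nat.even_add_one, Nat.not_even_iff_odd.mpr h, not_false_eq_true, if_true,
        if_false, hn, hE]
      field_simp
      ring
  · intro n
    by_cases h : Even n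
    · simp [h, Nat.even_add_one]
    · simp [h, Nat.even_add_one, h2]
  · simp [hE0]
  · simp
  · intro n h
    simp [h]
  · intro n h
    simp [Nat.not_even_iff_odd.mpr h]
  · simp [hE0]
  · intro n _ h
    simp [h, E]
  · intro n _ h
    have hn : n / 2 = (n - 1) / 2 := by grind
    simp only [Nat.not_even_iff_odd.mpr h, if_false, hn, E]
    ring
end

section
/- Suppose β₂ = 0, β₁α₂ ≠ 0 and β₁² = α₂. Then: (a) if α₁ ≠ 0, every complete solution of the system is unbounded except those with initial condition of the form (x₀, −β₁), which are periodic of period 2; (b) if α₁ = 0, the system is globally 2-periodic, i.e. every complete solution satisfies (x_{n+2}, y_{n+2}) = (x_n, y_n) for all n. -/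
open Filter Topology

/-- The solution `(x, y)` is bounded. -/
def BoundedSol (x y : ℕ → ℝ) : Prop :=
  Bornology.IsBounded (Set.range fun n => (x n, y n))

/-- For `β₂ = 0` and `α₂ = β₁²`, two steps of the system leave `y` unchanged and translate `x`. -/
theorem IsSol.add_two {a b : ℝ} (hb : b ≠ 0) {x y : ℕ → ℝ} (hs : IsSol a b (b ^ 2) 0 x y) (n : ℕ) :
    x (n + 2) = x n + a * (y n + b) / b ^ 2 ∧ y (n + 2) = y n := by
  obtain ⟨hy, hx, hy'⟩ := hs
  have hn := hy n
  have h1 : x (n + 2) = _ := hx (n + 1)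
  have h2 : y (n + 2) = _ := hy' (n + 1)
  rw [h1, h2, hx n, hy' n, zero_mul, zero_mul, add_zero]
  constructor
  · field_simp
    ring
  · field_simp

theorem IsSol.two_mul {a b : ℝ} (hb : b ≠ 0) {x y : ℕ → ℝ} (hs : IsSol a b (b ^ 2) 0 x y) (n : ℕ) :
    x (2 * n) = x 0 + n * (a * (y 0 + b) / b ^ 2) ∧ y (2 * n) = y 0 := by
  induction n with
  | zero => simp
  | succ k ih =>
    obtain ⟨h1, h2⟩ := hs.add_two hb (2 * k)
    rw [ih.1, ih.2] at h1
    refine ⟨h1.trans ?_, h2.trans ih.2⟩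
    push_cast
    ring

theorem IsSol.eq_neg {a b : ℝ} (hb : b ≠ 0) {x y : ℕ → ℝ} (hs : IsSol a b (b ^ 2) 0 x y)
    (h0 : y 0 = -b) (n : ℕ) : y n = -b := by
  induction n with
  | zero => exact h0
  | succ k ih =>
    rw [hs.2.2 k, ih]
    field_simp
    ring

theorem IsSol.not_boundedSol {a b : ℝ} (ha : a ≠ 0) (hb : b ≠ 0) {x y : ℕ → ℝ}
    (hs : IsSol a b (b ^ 2) 0 x y) (h0 : y 0 ≠ -b) : ¬ BoundedSol x y := by
  intro hbd
  obtain ⟨C, hC⟩ := isBounded_iff_forall_norm_le.1 hbd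
  have hx (n : ℕ) : |x n| ≤ C := (norm_fst_le (x n, y n)).trans (hC _ ⟨n, rfl⟩)
  set d := a * (y 0 + b) / b ^ 2 with hd
  have hd0 : 0 < |d| := abs_pos.2 <| div_ne_zero
    (mul_ne_zero ha fun h => h0 (eq_neg_of_add_eq_zero_left h)) (pow_ne_zero 2 hb)
  obtain ⟨n, hn⟩ := exists_nat_gt (2 * C / |d|)
  rw [div_lt_iff₀ hd0] at hn
  have hnd : (n : ℝ) * d = x (2 * n) - x 0 := by rw [(hs.two_mul hb n).1]; ring
  have habs : (n : ℝ) * |d| = |x (2 * n) - x 0| := by rw [← hnd, abs_mul, Nat.abs_cast]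
  linarith [abs_sub (x (2 * n)) (x 0), hx (2 * n), hx 0]

/-- for `β₂ = 0`, `β₁α₂ ≠ 0` and `β₁² = α₂`: if `α₁ ≠ 0`, every complete
solution is unbounded except those starting at `(x₀, −β₁)`, which are 2-periodic; if
`α₁ = 0`, the system is globally 2-periodic. -/
theorem stmt8 (a1 b1 a2 b2 : ℝ) (hb2 : b2 = 0) (hba : b1 * a2 ≠ 0) (h : b1 ^ 2 = a2) :
    (a1 ≠ 0 → ∀ x y : ℕ → ℝ, IsSol a1 b1 a2 b2 x y →
      (y 0 = -b1 → ∀ n, x (n + 2) = x n ∧ y (n + 2) = y n) ∧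
      (y 0 ≠ -b1 → ¬ BoundedSol x y)) ∧
    (a1 = 0 → ∀ x y : ℕ → ℝ, IsSol a1 b1 a2 b2 x y →
      ∀ n, x (n + 2) = x n ∧ y (n + 2) = y n) := by
  subst hb2 h
  have hb : b1 ≠ 0 := left_ne_zero_of_mul hba
  refine ⟨fun ha x y hs => ⟨fun h0 n => ?_, hs.not_boundedSol ha hb⟩, fun ha x y hs n => ?_⟩
  · simpa [hs.eq_neg hb h0 n] using hs.add_two hb n
  · simpa [ha] using hs.add_two hb n
end

section
/- Suppose β₂ = 0, β₁α₂ ≠ 0 and β₁² ≠ |α₂|. Then every complete solution with initial condition of the form (α₁(β₁ + y₀)/(α₂ − β₁²), y₀), y₀ ≠ 0, is periodic of period 2. Moreover: (a) if β₁² > |α₂|, every other complete solution of the system is unbounded; (b) if β₁² < |α₂|, every other complete solution is bounded and converges to one of the period-two solutions just described. -/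
open Filter Topology

/-- The first coordinate of the period-two solution of the system with `β₂ = 0` whose second
coordinate is `t`. -/
noncomputable def periodicPoint (a1 b1 a2 t : ℝ) : ℝ := a1 * (b1 + t) / (a2 - b1 ^ 2)

section

variable {a1 b1 a2 : ℝ} {x y : ℕ → ℝ}

theorem IsSol.mul_succ (hs : IsSol a1 b1 a2 0 x y) (n : ℕ) : y n * y (n + 1) = a2 := by
  rw [hs.2.2 n, zero_mul, add_zero, mul_div_cancel₀ _ (hs.1 n)]

theorem IsSol.snd_add_two (hs : IsSol a1 b1 a2 0 x y) (n : ℕ) :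
    y (n + 2) = y n := by
  have h1 := hs.mul_succ n
  have h2 := hs.mul_succ (n + 1)
  refine mul_left_cancel₀ (hs.1 (n + 1)) ?_
  rw [h2, mul_comm, h1]

theorem IsSol.periodicPoint (hD : a2 - b1 ^ 2 ≠ 0) (hs : IsSol a1 b1 a2 0 x y) :
    IsSol a1 b1 a2 0 (fun n => periodicPoint a1 b1 a2 (y n)) y := by
  refine ⟨hs.1, fun n => ?_, fun n => by rw [hs.2.2 n, zero_mul, zero_mul]⟩
  have hy := hs.1 n
  simp only [_root_.periodicPoint]
  rw [hs.2.2 n]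
  field_simp
  ring

theorem IsSol.sub_succ {u : ℕ → ℝ} (hs : IsSol a1 b1 a2 0 x y) (hu : IsSol a1 b1 a2 0 u y)
    (n : ℕ) : x (n + 1) - u (n + 1) = b1 / y n * (x n - u n) := by
  rw [hs.2.1, hu.2.1]
  ring

theorem IsSol.sub_add_two {u : ℕ → ℝ} (hs : IsSol a1 b1 a2 0 x y)
    (hu : IsSol a1 b1 a2 0 u y) (n : ℕ) :
    x (n + 2) - u (n + 2) = b1 ^ 2 / a2 * (x n - u n) := by
  rw [hs.sub_succ hu (n + 1), hs.sub_succ hu n, ← hs.mul_succ n]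
  have h0 := hs.1 n
  have h1 := hs.1 (n + 1)
  field_simp

end

theorem eq_pow_mul_of_add_two {d : ℕ → ℝ} {r : ℝ} (hd : ∀ n, d (n + 2) = r * d n) (j k : ℕ) :
    d (2 * k + j) = r ^ k * d j := by
  induction k with
  | zero => simp
  | succ k ih =>
    rw [show 2 * (k + 1) + j = 2 * k + j + 2 by ring, hd, ih]
    ring

theorem tendsto_zero_of_add_two {d : ℕ → ℝ} {r : ℝ} (hr : |r| < 1)
    (hd : ∀ n, d (n + 2) = r * d n) : Tendsto d atTop (𝓝 0) := by
  have hlim : Tendsto (fun n : ℕ => |r| ^ (n / 2) * (|d 0| + |d 1|)) atTop (𝓝 0) := by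
    simpa using ((tendsto_pow_atTop_nhds_zero_of_lt_one (abs_nonneg r) hr).comp
      (Nat.tendsto_div_const_atTop two_ne_zero)).mul_const (|d 0| + |d 1|)
  refine squeeze_zero_norm (fun n => ?_) hlim
  have h := eq_pow_mul_of_add_two hd (n % 2) (n / 2)
  rw [Nat.div_add_mod] at h
  rw [h, norm_mul, norm_pow, Real.norm_eq_abs, Real.norm_eq_abs]
  gcongr
  rcases Nat.mod_two_eq_zero_or_one n with h | h <;> rw [h]
  · exact le_add_of_nonneg_right (abs_nonneg _)
  · exact le_add_of_nonneg_left (abs_nonneg _)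

theorem not_isBounded_range_of_add_two {d : ℕ → ℝ} {r : ℝ} (hr : 1 < |r|) (h0 : d 0 ≠ 0)
    (hd : ∀ n, d (n + 2) = r * d n) : ¬ Bornology.IsBounded (Set.range d) := by
  intro hb
  obtain ⟨C, hC⟩ := hb.exists_norm_le
  obtain ⟨k, hk⟩ := pow_unbounded_of_one_lt (C / |d 0|) hr
  have h := hC _ ⟨2 * k + 0, rfl⟩
  rw [eq_pow_mul_of_add_two hd, norm_mul, norm_pow, Real.norm_eq_abs, Real.norm_eq_abs] at h
  rw [div_lt_iff₀ (abs_pos.mpr h0)] at hk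
  exact absurd h hk.not_ge

theorem isBounded_range_of_add_two {α : Type*} [Bornology α] {f : ℕ → α}
    (hf : ∀ n, f (n + 2) = f n) : Bornology.IsBounded (Set.range f) := by
  refine (Set.toFinite {f 0, f 1}).isBounded.subset ?_
  rintro _ ⟨n, rfl⟩
  rw [show f n = f (n % 2) from ((show Function.Periodic f 2 from hf).map_mod_nat n).symm]
  rcases Nat.mod_two_eq_zero_or_one n with h | h <;> simp [h]

/-- for `β₂ = 0`, `β₁α₂ ≠ 0` and `β₁² ≠ |α₂|`: solutions starting at
`(α₁(β₁ + y₀)/(α₂ − β₁²), y₀)` are 2-periodic; if `β₁² > |α₂|` every other complete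
solution is unbounded; if `β₁² < |α₂|` every other complete solution is bounded and
converges to one of those period-two solutions. -/
theorem stmt10 (a1 b1 a2 b2 : ℝ) (hb2 : b2 = 0) (hba : b1 * a2 ≠ 0)
    (h : b1 ^ 2 ≠ |a2|) :
    (∀ x y : ℕ → ℝ, IsSol a1 b1 a2 b2 x y →
      x 0 = a1 * (b1 + y 0) / (a2 - b1 ^ 2) →
      ∀ n, x (n + 2) = x n ∧ y (n + 2) = y n) ∧
    (|a2| < b1 ^ 2 → ∀ x y : ℕ → ℝ, IsSol a1 b1 a2 b2 x y →
      x 0 ≠ a1 * (b1 + y 0) / (a2 - b1 ^ 2) → ¬ BoundedSol x y) ∧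
    (b1 ^ 2 < |a2| → ∀ x y : ℕ → ℝ, IsSol a1 b1 a2 b2 x y →
      x 0 ≠ a1 * (b1 + y 0) / (a2 - b1 ^ 2) →
      BoundedSol x y ∧ ∃ a b : ℕ → ℝ, IsSol a1 b1 a2 b2 a b ∧
        a 0 = a1 * (b1 + b 0) / (a2 - b1 ^ 2) ∧
        Tendsto (fun n => (x n - a n, y n - b n)) atTop (𝓝 (0, 0))) := by
  subst hb2
  have ha : a2 ≠ 0 := right_ne_zero_of_mul hba
  have hD : a2 - b1 ^ 2 ≠ 0 := fun h0 => h (by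
    rw [sub_eq_zero.mp h0, abs_of_nonneg (sq_nonneg b1)])
  have hr : |b1 ^ 2 / a2| = b1 ^ 2 / |a2| := by
    rw [abs_div, abs_of_nonneg (sq_nonneg b1)]
  refine ⟨fun x y hs h0 n => ?_, fun hlt x y hs h0 hb => ?_, fun hlt x y hs _ => ?_⟩
  · have hu := hs.periodicPoint hD
    have hx : ∀ m, x m = periodicPoint a1 b1 a2 (y m) := by
      intro m
      induction m with
      | zero => exact h0
      | succ m ih => rw [← sub_eq_zero, hs.sub_succ hu, ih, sub_self, mul_zero]
    exact ⟨by rw [hx, hx, hs.snd_add_two], hs.snd_add_two n⟩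
  · have hu := hs.periodicPoint hD
    refine not_isBounded_range_of_add_two
      (d := fun n => x n - periodicPoint a1 b1 a2 (y n)) ?_ (sub_ne_zero.mpr h0)
      (hs.sub_add_two hu) ?_
    · rwa [hr, one_lt_div (abs_pos.mpr ha)]
    · have hx : Bornology.IsBounded (Set.range x) :=
        hb.image_fst.subset (by rintro _ ⟨n, rfl⟩; exact ⟨_, ⟨n, rfl⟩, rfl⟩)
      have hp : Bornology.IsBounded (Set.range fun n => periodicPoint a1 b1 a2 (y n)) :=
        isBounded_range_of_add_two fun n => by rw [hs.snd_add_two]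
      refine (hx.sub hp).subset ?_
      rintro _ ⟨n, rfl⟩
      exact Set.sub_mem_sub ⟨n, rfl⟩ ⟨n, rfl⟩
  · have hu := hs.periodicPoint hD
    have hlim : Tendsto (fun n => (x n - periodicPoint a1 b1 a2 (y n), y n - y n)) atTop
        (𝓝 ((0 : ℝ), (0 : ℝ))) := by
      refine (tendsto_zero_of_add_two ?_ (hs.sub_add_two hu)).prodMk_nhds (by simp)
      rwa [hr, div_lt_one (abs_pos.mpr ha)]
    refine ⟨?_, _, y, hu, rfl, hlim⟩
    have hp : Bornology.IsBounded (Set.range fun n => (periodicPoint a1 b1 a2 (y n), y n)) :=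
      isBounded_range_of_add_two fun n => by rw [hs.snd_add_two]
    refine ((Metric.isBounded_range_of_tendsto _ hlim).add hp).subset ?_
    rintro _ ⟨n, rfl⟩
    exact Set.mem_add.mpr ⟨_, ⟨n, rfl⟩, _, ⟨n, rfl⟩, by simp⟩
end

section
/- Suppose β₂ = 0 and β₁α₂ ≠ 0. Then: (1) if β₁² = α₂, then (a) for α₁ ≠ 0 the unique equilibrium of the system is unstable, and (b) for α₁ = 0 every equilibrium of the system is stable but not asymptotically stable; (2) if α₂ > 0 and β₁² ≠ α₂, then (a) for β₁² > α₂ both equilibria of the system are unstable, and (b) for β₁² < α₂ both equilibria are stable but not asymptotically stable. -/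
open Filter Topology

/-- The equilibrium `p` is stable. -/
def Stable (a1 b1 a2 b2 : ℝ) (p : ℝ × ℝ) : Prop :=
  ∀ ε > 0, ∃ δ > 0, ∀ x y : ℕ → ℝ, IsSol a1 b1 a2 b2 x y →
    dist (x 0, y 0) p < δ → ∀ n, dist (x n, y n) p < ε

/-- The equilibrium `p` is asymptotically stable. -/
def AsympStable (a1 b1 a2 b2 : ℝ) (p : ℝ × ℝ) : Prop :=
  Stable a1 b1 a2 b2 p ∧ ∃ δ > 0, ∀ x y : ℕ → ℝ, IsSol a1 b1 a2 b2 x y →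
    dist (x 0, y 0) p < δ → Tendsto (fun n => (x n, y n)) atTop (𝓝 p)

namespace IsSol

variable {a1 b1 a2 : ℝ} {x y : ℕ → ℝ}

lemma y_add_two (h : IsSol a1 b1 a2 0 x y) (ha : a2 ≠ 0) (n : ℕ) : y (n + 2) = y n := by
  have hn := h.1 n
  rw [h.2.2 (n + 1), h.2.2 n]
  field_simp
  simp [ha]

lemma y_two_mul (h : IsSol a1 b1 a2 0 x y) (ha : a2 ≠ 0) (n : ℕ) : y (2 * n) = y 0 := by
  induction n with
  | zero => rfl
  | succ n ih => rw [show 2 * (n + 1) = 2 * n + 2 by ring, h.y_add_two ha, ih]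

lemma x_add_two (h : IsSol a1 b1 a2 0 x y) (ha : a2 ≠ 0) (n : ℕ) :
    x (n + 2) = b1 ^ 2 / a2 * x n + a1 * (y n + b1) / a2 := by
  have hn := h.1 n
  rw [h.2.1 (n + 1), h.2.1 n, h.2.2 n, zero_mul, add_zero]
  field_simp
  ring

/-- The even-indexed `x`-terms move geometrically about a fixed point of the twice iterated map. -/
lemma x_two_mul_sub (h : IsSol a1 b1 a2 0 x y) (ha : a2 ≠ 0) {q : ℝ}
    (hq : q = b1 ^ 2 / a2 * q + a1 * (y 0 + b1) / a2) (n : ℕ) :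
    x (2 * n) - q = (b1 ^ 2 / a2) ^ n * (x 0 - q) := by
  induction n with
  | zero => simp
  | succ n ih =>
    rw [show 2 * (n + 1) = 2 * n + 2 by ring, h.x_add_two ha, h.y_two_mul ha, pow_succ']
    linear_combination b1 ^ 2 / a2 * ih - hq

lemma x_two_mul_of_sq_eq (h : IsSol a1 b1 a2 0 x y) (ha : a2 ≠ 0) (hb : b1 ^ 2 = a2) (n : ℕ) :
    x (2 * n) = x 0 + n * (a1 * (y 0 + b1) / a2) := by
  induction n with
  | zero => simp
  | succ n ih =>
    rw [show 2 * (n + 1) = 2 * n + 2 by ring, h.x_add_two ha, h.y_two_mul ha, ih, hb, div_self ha]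
    push_cast
    ring

end IsSol

lemma exists_isSol {a1 b1 a2 : ℝ} (ha : a2 ≠ 0) (x0 : ℝ) {y0 : ℝ} (hy : y0 ≠ 0) :
    ∃ x y : ℕ → ℝ, IsSol a1 b1 a2 0 x y ∧ x 0 = x0 ∧ y 0 = y0 := by
  let F : ℝ × ℝ → ℝ × ℝ := fun p => ((a1 + b1 * p.1) / p.2, (a2 + 0 * p.1) / p.2)
  refine ⟨fun n => (F^[n] (x0, y0)).1, fun n => (F^[n] (x0, y0)).2, ⟨fun n => ?_, fun n => ?_,
    fun n => ?_⟩, rfl, rfl⟩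
  · induction n with
    | zero => exact hy
    | succ n ih =>
      simp only [Function.iterate_succ_apply']
      exact div_ne_zero (by simpa using ha) ih
  · simp only [Function.iterate_succ_apply', F]
  · simp only [Function.iterate_succ_apply', F]

lemma exists_ne_zero_ne_near {b δ : ℝ} (hb : b ≠ 0) (hδ : 0 < δ) :
    ∃ y, y ≠ 0 ∧ y ≠ b ∧ dist y b < δ := by
  have h1 : ∀ᶠ y in 𝓝[≠] b, y ≠ 0 := (eventually_ne_nhds hb).filter_mono nhdsWithin_le_nhds
  have h2 : ∀ᶠ y in 𝓝[≠] b, dist y b < δ :=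
    (Metric.eventually_nhds_iff.2 ⟨δ, hδ, fun _ h => h⟩ : ∀ᶠ y in 𝓝 b, dist y b < δ).filter_mono
      nhdsWithin_le_nhds
  obtain ⟨y, ⟨hy, hy'⟩, hyb⟩ := ((h1.and h2).and self_mem_nhdsWithin).exists
  exact ⟨y, hy, hyb, hy'⟩

lemma IsEquilib.sq_eq {a1 b1 a2 : ℝ} {p : ℝ × ℝ} (hp : IsEquilib a1 b1 a2 0 p) :
    p.2 ^ 2 = a2 := by
  have h := hp.2.2
  rw [eq_div_iff hp.1] at h
  linarith

lemma IsEquilib.fst_mul {a1 b1 a2 : ℝ} {p : ℝ × ℝ} (hp : IsEquilib a1 b1 a2 0 p) :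
    p.1 * p.2 = a1 + b1 * p.1 :=
  (eq_div_iff hp.1).1 hp.2.1

lemma not_asympStable {a1 b1 a2 : ℝ} (ha : a2 ≠ 0) {p : ℝ × ℝ} (hp : p.2 ≠ 0) :
    ¬ AsympStable a1 b1 a2 0 p := by
  rintro ⟨-, δ, hδ, H⟩
  obtain ⟨y0, hy0, hyp, hd⟩ := exists_ne_zero_ne_near hp hδ
  obtain ⟨x, y, hs, hx, hy⟩ := exists_isSol (a1 := a1) (b1 := b1) ha p.1 hy0
  have ht := H x y hs (by simpa [Prod.dist_eq, hx, hy] using hd)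
  have ht2 : Tendsto (fun n => y (2 * n)) atTop (𝓝 p.2) :=
    ((continuous_snd.tendsto p).comp ht).comp
      (tendsto_id.const_mul_atTop' (by norm_num : 0 < 2))
  simp only [hs.y_two_mul ha, hy] at ht2
  exact hyp (tendsto_nhds_unique tendsto_const_nhds ht2)

lemma not_stable_of_unbounded {a1 b1 a2 b2 : ℝ} {p : ℝ × ℝ}
    (H : ∀ δ > 0, ∃ x y : ℕ → ℝ, IsSol a1 b1 a2 b2 x y ∧ dist (x 0, y 0) p < δ ∧
      ∃ n, 1 ≤ |x n - p.1|) : ¬ Stable a1 b1 a2 b2 p := by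
  intro hst
  obtain ⟨δ, hδ, h⟩ := hst 1 one_pos
  obtain ⟨x, y, hs, hd, n, hn⟩ := H δ hδ
  have := h x y hs hd n
  rw [Prod.dist_eq, max_lt_iff, Real.dist_eq] at this
  exact absurd this.1 (not_lt.2 hn)

lemma not_stable_of_sq_eq {a1 b1 a2 : ℝ} (ha : a2 ≠ 0) (ha1 : a1 ≠ 0) (hb : b1 ^ 2 = a2)
    {p : ℝ × ℝ} (hp : IsEquilib a1 b1 a2 0 p) : ¬ Stable a1 b1 a2 0 p := by
  have hpb : p.2 = -b1 := by
    rcases sq_eq_sq_iff_eq_or_eq_neg.1 (hp.sq_eq.trans hb.symm) with h | h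
    · have := hp.fst_mul
      rw [h] at this
      exact absurd (by linarith) ha1
    · exact h
  refine not_stable_of_unbounded fun δ hδ => ?_
  obtain ⟨y0, hy0, hyp, hd⟩ := exists_ne_zero_ne_near hp.1 hδ
  obtain ⟨x, y, hs, hx, hy⟩ := exists_isSol (a1 := a1) (b1 := b1) ha p.1 hy0
  refine ⟨x, y, hs, by simpa [Prod.dist_eq, hx, hy] using hd, ?_⟩
  have hc : a1 * (y0 + b1) / a2 ≠ 0 :=
    div_ne_zero (mul_ne_zero ha1 fun h => hyp (by linarith)) ha
  obtain ⟨n, hn⟩ := exists_nat_ge (1 / |a1 * (y0 + b1) / a2|)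
  refine ⟨2 * n, ?_⟩
  rw [hs.x_two_mul_of_sq_eq ha hb, hx, hy, add_sub_cancel_left, abs_mul, Nat.abs_cast]
  exact (div_le_iff₀ (abs_pos.2 hc)).1 hn

lemma IsEquilib.fst_eq {a1 b1 a2 : ℝ} (ha : a2 ≠ 0) {p : ℝ × ℝ} (hp : IsEquilib a1 b1 a2 0 p) :
    p.1 = b1 ^ 2 / a2 * p.1 + a1 * (p.2 + b1) / a2 := by
  field_simp
  linear_combination (p.2 + b1) * hp.fst_mul - p.1 * hp.sq_eq

lemma not_stable_of_lt_sq {a1 b1 a2 : ℝ} (ha : 0 < a2) (hb : a2 < b1 ^ 2)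
    {p : ℝ × ℝ} (hp : IsEquilib a1 b1 a2 0 p) : ¬ Stable a1 b1 a2 0 p := by
  refine not_stable_of_unbounded fun δ hδ => ?_
  obtain ⟨x, y, hs, hx, hy⟩ := exists_isSol (a1 := a1) (b1 := b1) ha.ne' (p.1 + δ / 2) hp.1
  refine ⟨x, y, hs, ?_, ?_⟩
  · rw [Prod.dist_eq, max_lt_iff, hx, hy, Real.dist_eq, add_sub_cancel_left, abs_of_pos (by linarith)]
    exact ⟨by linarith, by simpa using hδ⟩
  obtain ⟨n, hn⟩ := pow_unbounded_of_one_lt (1 / (δ / 2)) ((one_lt_div ha).2 hb)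
  refine ⟨2 * n, ?_⟩
  rw [hs.x_two_mul_sub ha.ne' (hy ▸ hp.fst_eq ha.ne'), hx, add_sub_cancel_left]
  exact ((div_le_iff₀ (by linarith)).1 hn.le).trans (le_abs_self _)

/-- Stability, given a continuous branch `q` of fixed points of the twice iterated map. -/
lemma stable_of_fixed_branch {a1 b1 a2 : ℝ} (ha : 0 < a2) (hb : b1 ^ 2 ≤ a2)
    {p : ℝ × ℝ} (hp : IsEquilib a1 b1 a2 0 p) {q : ℝ → ℝ} (hqc : ContinuousAt q p.2)
    (hqp : q p.2 = p.1) (hq : ∀ y, q y = b1 ^ 2 / a2 * q y + a1 * (y + b1) / a2) :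
    Stable a1 b1 a2 0 p := by
  have even_close : ∀ ε > 0, ∃ δ > 0, ∀ x y : ℕ → ℝ, IsSol a1 b1 a2 0 x y →
      dist (x 0, y 0) p < δ → ∀ n, dist (x (2 * n), y (2 * n)) p < ε := by
    intro ε hε
    obtain ⟨δ, hδ, H⟩ := Metric.continuousAt_iff.1 hqc (ε / 3) (by linarith)
    refine ⟨min δ (ε / 3), lt_min hδ (by linarith), fun x y hs hd n => ?_⟩
    rw [Prod.dist_eq, max_lt_iff, lt_min_iff, lt_min_iff] at hd
    rw [Prod.dist_eq, max_lt_iff]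
    simp only at hd ⊢
    refine ⟨?_, by rw [hs.y_two_mul ha.ne']; linarith⟩
    have h1 := H hd.2.1
    rw [hqp] at h1
    have h2 : dist (x (2 * n)) (q (y 0)) ≤ dist (x 0) (q (y 0)) := by
      rw [Real.dist_eq, Real.dist_eq, hs.x_two_mul_sub ha.ne' (hq _), abs_mul]
      refine mul_le_of_le_one_left (abs_nonneg _) ?_
      have h0 : 0 ≤ b1 ^ 2 / a2 := by positivity
      rw [abs_of_nonneg (by positivity)]
      exact pow_le_one₀ h0 ((div_le_one ha).2 hb)
    have h3 := dist_triangle (x (2 * n)) (q (y 0)) p.1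
    have h4 := dist_triangle_right (x 0) (q (y 0)) p.1
    linarith [hd.1.2]
  intro ε hε
  have hF : ContinuousAt (fun z : ℝ × ℝ => ((a1 + b1 * z.1) / z.2, (a2 + 0 * z.1) / z.2)) p := by
    have := hp.1
    fun_prop (disch := assumption)
  obtain ⟨η, hη, H⟩ := Metric.continuousAt_iff.1 hF ε hε
  rw [← hp.2.1, ← hp.2.2] at H
  obtain ⟨δ, hδ, h⟩ := even_close (min η ε) (lt_min hη hε)
  refine ⟨δ, hδ, fun x y hs hd n => ?_⟩
  obtain ⟨m, rfl | rfl⟩ := n.even_or_odd'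
  · exact (h x y hs hd m).trans_le (min_le_right _ _)
  · rw [hs.2.1, hs.2.2]
    exact H ((h x y hs hd m).trans_le (min_le_left _ _))

/-- stability of the equilibria when `β₂ = 0` and `β₁α₂ ≠ 0`. -/
theorem stmt11 (a1 b1 a2 b2 : ℝ) (hb2 : b2 = 0) (hba : b1 * a2 ≠ 0) :
    (b1 ^ 2 = a2 →
      (a1 ≠ 0 → ∀ p : ℝ × ℝ, IsEquilib a1 b1 a2 b2 p → ¬ Stable a1 b1 a2 b2 p) ∧
      (a1 = 0 → ∀ p : ℝ × ℝ, IsEquilib a1 b1 a2 b2 p →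
        Stable a1 b1 a2 b2 p ∧ ¬ AsympStable a1 b1 a2 b2 p)) ∧
    (0 < a2 → b1 ^ 2 ≠ a2 →
      (a2 < b1 ^ 2 → ∀ p : ℝ × ℝ, IsEquilib a1 b1 a2 b2 p → ¬ Stable a1 b1 a2 b2 p) ∧
      (b1 ^ 2 < a2 → ∀ p : ℝ × ℝ, IsEquilib a1 b1 a2 b2 p →
        Stable a1 b1 a2 b2 p ∧ ¬ AsympStable a1 b1 a2 b2 p)) := by
  subst hb2
  have ha : a2 ≠ 0 := right_ne_zero_of_mul hba
  have hb : b1 ≠ 0 := left_ne_zero_of_mul hba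
  refine ⟨fun hsq => ⟨fun ha1 p hp => not_stable_of_sq_eq ha ha1 hsq hp, fun ha1 p hp =>
    ⟨?_, not_asympStable ha hp.1⟩⟩, fun hpos _ => ⟨fun hlt p hp => not_stable_of_lt_sq hpos hlt hp,
    fun hlt p hp => ⟨?_, not_asympStable ha hp.1⟩⟩⟩
  · refine stable_of_fixed_branch (hsq ▸ by positivity) hsq.le hp
      (q := fun _ => p.1) continuousAt_const rfl fun y => ?_
    rw [hsq, ha1, div_self ha]
    ring
  · have hne : a2 - b1 ^ 2 ≠ 0 := (sub_pos.2 hlt).ne'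
    refine stable_of_fixed_branch hpos hlt.le hp
      (q := fun y => a1 * (y + b1) / (a2 - b1 ^ 2)) (by fun_prop) ?_ fun y => ?_
    · have h := hp.fst_eq ha
      field_simp at h
      rw [div_eq_iff hne]
      linarith
    · field_simp
      ring
end

section
/- Suppose β₂ ≠ 0 and let (x_n, y_n) be a complete solution of the system with initial condition (x₀, y₀). Let (v_n)_{n ≥ −1} be the unique solution of the third-order linear difference equation v_{n+3} − β₁v_{n+2} − α₂v_{n+1} + (β₁α₂ − β₂α₁)v_n = 0 with initial conditions v_{−1} = 1, v₀ = y₀ and v₁ = β₂x₀ + α₂. Then v_{n−1} ≠ 0 for all n ≥ 0 and, for all n ≥ 0, x_n = (1/β₂)·(v_{n+1}/v_{n−1}) − α₂/β₂ and y_n = v_n/v_{n−1}. -/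
open Filter Topology

/-- for `β₂ ≠ 0`, any complete solution is given by
`xₙ = (1/β₂)(v_{n+1}/v_{n−1}) − α₂/β₂`, `yₙ = vₙ/v_{n−1}` where `v` solves the linear
equation `v_{n+3} − β₁v_{n+2} − α₂v_{n+1} + (β₁α₂ − β₂α₁)vₙ = 0` with `v_{−1} = 1`,
`v₀ = y₀`, `v₁ = β₂x₀ + α₂`. (Here `v n` denotes `v_{n−1}`, shifting indices by one.) -/
theorem stmt12 (a1 b1 a2 b2 : ℝ) (hb2 : b2 ≠ 0)
    (x y : ℕ → ℝ) (hsol : IsSol a1 b1 a2 b2 x y)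
    (v : ℕ → ℝ) (hv0 : v 0 = 1) (hv1 : v 1 = y 0) (hv2 : v 2 = b2 * x 0 + a2)
    (hrec : ∀ n, v (n + 3) - b1 * v (n + 2) - a2 * v (n + 1) +
      (b1 * a2 - b2 * a1) * v n = 0) :
    ∀ n, v n ≠ 0 ∧ x n = 1 / b2 * (v (n + 2) / v n) - a2 / b2 ∧
      y n = v (n + 1) / v n := by
  obtain ⟨hy, hx, hy'⟩ := hsol
  have key : ∀ n, v n ≠ 0 ∧ v (n + 1) = y n * v n ∧ v (n + 2) = (b2 * x n + a2) * v n := by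
    intro n
    induction n with
    | zero => simp [hv0, hv1, hv2]
    | succ n ih =>
      obtain ⟨h0, h1, h2⟩ := ih
      have hX : x (n + 1) * y n = a1 + b1 * x n := by rw [hx, div_mul_cancel₀ _ (hy n)]
      have hY : y (n + 1) * y n = a2 + b2 * x n := by rw [hy', div_mul_cancel₀ _ (hy n)]
      refine ⟨h1 ▸ mul_ne_zero (hy n) h0, ?_, ?_⟩
      · linear_combination h2 - y (n + 1) * h1 - v n * hY
      · linear_combination hrec n + b1 * h2 - b2 * x (n + 1) * h1 - b2 * v n * hX
  intro n
  obtain ⟨h0, h1, h2⟩ := key n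
  refine ⟨h0, ?_, ?_⟩
  · rw [h2, mul_div_cancel_right₀ _ h0]
    field_simp
    ring
  · rw [h1, mul_div_cancel_right₀ _ h0]
end

section
/- Suppose β₂ ≠ 0, α₁β₂ ≠ α₂β₁, and the characteristic polynomial λ³ − β₁λ² − α₂λ + (β₁α₂ − β₂α₁) has three real roots λ₁, λ₂, λ₃ with |λ₁| > |λ₂| > |λ₃|. Let L be the line {(x, y) ∈ ℝ² : β₂x = (β₁ − λ₁)(y + λ₁)}. Then: (a) the equilibria of the system are exactly the three points ((λᵢ² − α₂)/β₂, λᵢ), i = 1, 2, 3; (b) every complete solution whose initial condition does not lie on L converges to ((λ₁² − α₂)/β₂, λ₁); (c) every complete solution whose initial condition lies on L and differs from ((λ₃² − α₂)/β₂, λ₃) converges to ((λ₂² − α₂)/β₂, λ₂). -/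
open Filter Topology

/-- The coordinate of `(x, y, 1)` along the left eigenvector of the associated matrix for the
eigenvalue `l`. -/
def eigenForm (b1 b2 l x y : ℝ) : ℝ := b2 * x + (l - b1) * (y + l)

section

variable {a1 b1 a2 b2 : ℝ}

theorem vieta_of_char_eq {l1 l2 l3 : ℝ}
    (hfact : ∀ z : ℝ, z ^ 3 - b1 * z ^ 2 - a2 * z + (b1 * a2 - b2 * a1) =
      (z - l1) * (z - l2) * (z - l3)) :
    b1 = l1 + l2 + l3 ∧ a2 = -(l1 * l2 + l1 * l3 + l2 * l3) ∧
      b2 * a1 = b1 * a2 + l1 * l2 * l3 := by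
  have h0 := hfact 0
  have h1 := hfact 1
  have h2 := hfact (-1)
  refine ⟨?_, ?_, ?_⟩
  · linear_combination h0 - h1 / 2 - h2 / 2
  · linear_combination h2 / 2 - h1 / 2
  · linear_combination -h0

theorem isEquilib_iff (hb2 : b2 ≠ 0) (p : ℝ × ℝ) :
    IsEquilib a1 b1 a2 b2 p ↔ p.2 ≠ 0 ∧ p.1 = (p.2 ^ 2 - a2) / b2 ∧
      p.2 ^ 3 - b1 * p.2 ^ 2 - a2 * p.2 + (b1 * a2 - b2 * a1) = 0 := by
  unfold IsEquilib
  refine and_congr_right fun hy => ?_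
  rw [eq_div_iff hy, eq_div_iff hy, eq_div_iff hb2]
  constructor
  · rintro ⟨h1, h2⟩
    exact ⟨by linear_combination -h2, by linear_combination b2 * h1 + (p.2 - b1) * h2⟩
  · rintro ⟨h1, h2⟩
    refine ⟨mul_left_cancel₀ hb2 ?_, by linear_combination -h1⟩
    linear_combination h2 + (p.2 - b1) * h1

theorem IsSol.eigenForm_succ {x y : ℕ → ℝ} (h : IsSol a1 b1 a2 b2 x y) {l : ℝ}
    (hl : l ^ 3 - b1 * l ^ 2 - a2 * l + (b1 * a2 - b2 * a1) = 0) (n : ℕ) :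
    eigenForm b1 b2 l (x (n + 1)) (y (n + 1)) = l / y n * eigenForm b1 b2 l (x n) (y n) := by
  obtain ⟨hy, hx', hy'⟩ := h
  have := hy n
  unfold eigenForm
  rw [hx', hy']
  field_simp
  linear_combination -hl

theorem IsSol.eigenForm_ne_zero {x y : ℕ → ℝ} (h : IsSol a1 b1 a2 b2 x y) {l : ℝ}
    (hl : l ^ 3 - b1 * l ^ 2 - a2 * l + (b1 * a2 - b2 * a1) = 0) (hl0 : l ≠ 0)
    (h0 : eigenForm b1 b2 l (x 0) (y 0) ≠ 0) (n : ℕ) :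
    eigenForm b1 b2 l (x n) (y n) ≠ 0 := by
  induction n with
  | zero => exact h0
  | succ n ih =>
    rw [h.eigenForm_succ hl]
    exact mul_ne_zero (div_ne_zero hl0 (h.1 n)) ih

theorem IsSol.eigenForm_div {x y : ℕ → ℝ} (h : IsSol a1 b1 a2 b2 x y) {l m : ℝ}
    (hl : l ^ 3 - b1 * l ^ 2 - a2 * l + (b1 * a2 - b2 * a1) = 0)
    (hm : m ^ 3 - b1 * m ^ 2 - a2 * m + (b1 * a2 - b2 * a1) = 0) (n : ℕ) :
    eigenForm b1 b2 m (x n) (y n) / eigenForm b1 b2 l (x n) (y n) =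
      (m / l) ^ n * (eigenForm b1 b2 m (x 0) (y 0) / eigenForm b1 b2 l (x 0) (y 0)) := by
  induction n with
  | zero => simp
  | succ n ih =>
    rw [h.eigenForm_succ hl, h.eigenForm_succ hm, mul_div_mul_comm,
      div_div_div_cancel_right₀ (h.1 n), ih, pow_succ']
    ring

theorem IsSol.tendsto_eigenForm_div {x y : ℕ → ℝ} (h : IsSol a1 b1 a2 b2 x y) {l m : ℝ}
    (hl : l ^ 3 - b1 * l ^ 2 - a2 * l + (b1 * a2 - b2 * a1) = 0)
    (hm : m ^ 3 - b1 * m ^ 2 - a2 * m + (b1 * a2 - b2 * a1) = 0)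
    (hlm : eigenForm b1 b2 m (x 0) (y 0) = 0 ∨ |m| < |l|) :
    Tendsto (fun n => eigenForm b1 b2 m (x n) (y n) / eigenForm b1 b2 l (x n) (y n))
      atTop (𝓝 0) := by
  rw [funext (h.eigenForm_div hl hm)]
  rcases hlm with h0 | hlt
  · simp [h0]
  · have hlt' : |m / l| < 1 := by
      rw [abs_div]
      exact (div_lt_one ((abs_nonneg m).trans_lt hlt)).2 hlt
    simpa using (tendsto_pow_atTop_nhds_zero_of_abs_lt_one hlt').mul_const
      (eigenForm b1 b2 m (x 0) (y 0) / eigenForm b1 b2 l (x 0) (y 0))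

/-- A solution with nonzero component along the eigenvalue `l` converges to the corresponding
equilibrium as soon as each other component vanishes or belongs to a smaller eigenvalue. -/
theorem IsSol.tendsto_equilib {x y : ℕ → ℝ} (h : IsSol a1 b1 a2 b2 x y) (hb2 : b2 ≠ 0)
    {l m k : ℝ}
    (hfact : ∀ z : ℝ, z ^ 3 - b1 * z ^ 2 - a2 * z + (b1 * a2 - b2 * a1) =
      (z - l) * (z - m) * (z - k))
    (hl0 : l ≠ 0) (hlm : l ≠ m) (hlk : l ≠ k) (hmk : m ≠ k)
    (hl : eigenForm b1 b2 l (x 0) (y 0) ≠ 0)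
    (hm : eigenForm b1 b2 m (x 0) (y 0) = 0 ∨ |m| < |l|)
    (hk : eigenForm b1 b2 k (x 0) (y 0) = 0 ∨ |k| < |l|) :
    Tendsto (fun n => (x n, y n)) atTop (𝓝 ((l ^ 2 - a2) / b2, l)) := by
  have rl : l ^ 3 - b1 * l ^ 2 - a2 * l + (b1 * a2 - b2 * a1) = 0 := by rw [hfact]; ring
  have rm : m ^ 3 - b1 * m ^ 2 - a2 * m + (b1 * a2 - b2 * a1) = 0 := by rw [hfact]; ring
  have rk : k ^ 3 - b1 * k ^ 2 - a2 * k + (b1 * a2 - b2 * a1) = 0 := by rw [hfact]; ring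
  obtain ⟨hb, ha, -⟩ := vieta_of_char_eq hfact
  have tm := h.tendsto_eigenForm_div rl rm hm
  have tk := h.tendsto_eigenForm_div rl rk hk
  have hne := h.eigenForm_ne_zero rl hl0 hl
  set f := fun n => eigenForm b1 b2 m (x n) (y n) / eigenForm b1 b2 l (x n) (y n) with hf
  set g := fun n => eigenForm b1 b2 k (x n) (y n) / eigenForm b1 b2 l (x n) (y n) with hg
  have combo (p q r : ℝ) :
      Tendsto (fun n => p * (m - k) - q * (l - k) * f n + r * (l - m) * g n) atTop
        (𝓝 (p * (m - k))) := by
    simpa using (tendsto_const_nhds.sub (tm.const_mul (q * (l - k)))).add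
      (tk.const_mul (r * (l - m)))
  have den (n : ℕ) : 1 * (m - k) - 1 * (l - k) * f n + 1 * (l - m) * g n =
      (l - m) * (l - k) * (m - k) / eigenForm b1 b2 l (x n) (y n) := by
    have := hne n
    simp only [hf, hg]
    field_simp
    unfold eigenForm
    ring
  have hD : (l - m) * (l - k) * (m - k) ≠ 0 :=
    mul_ne_zero (mul_ne_zero (sub_ne_zero.2 hlm) (sub_ne_zero.2 hlk)) (sub_ne_zero.2 hmk)
  have lim (p q r : ℝ) :
      Tendsto (fun n => (p * (m - k) - q * (l - k) * f n + r * (l - m) * g n) /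
        (1 * (m - k) - 1 * (l - k) * f n + 1 * (l - m) * g n)) atTop (𝓝 p) := by
    have := (combo p q r).div (combo 1 1 1) (by simpa using sub_ne_zero.2 hmk)
    rwa [mul_div_mul_right _ _ (sub_ne_zero.2 hmk), div_one] at this
  have hy : Tendsto y atTop (𝓝 l) := by
    refine (lim l m k).congr fun n => ?_
    rw [den, div_eq_iff (div_ne_zero hD (hne n))]
    have := hne n
    simp only [hf, hg]
    field_simp
    unfold eigenForm
    rw [hb]
    ring
  have hx : Tendsto x atTop (𝓝 ((l ^ 2 - a2) / b2)) := by
    refine (lim ((l ^ 2 - a2) / b2) ((m ^ 2 - a2) / b2) ((k ^ 2 - a2) / b2)).congr fun n => ?_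
    rw [den, div_eq_iff (div_ne_zero hD (hne n))]
    have := hne n
    simp only [hf, hg]
    field_simp
    unfold eigenForm
    rw [ha, hb]
    ring
  exact hx.prodMk_nhds hy

end

/-- three real characteristic roots `λ₁, λ₂, λ₃` with
`|λ₁| > |λ₂| > |λ₃|`: the three equilibria, convergence to the first one off the line
`L : β₂x = (β₁ − λ₁)(y + λ₁)`, and convergence to the second one on `L` away from the
third equilibrium. -/
theorem stmt13 (a1 b1 a2 b2 : ℝ) (hb2 : b2 ≠ 0) (hd : a1 * b2 ≠ a2 * b1)
    (l1 l2 l3 : ℝ)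
    (hfact : ∀ z : ℝ, z ^ 3 - b1 * z ^ 2 - a2 * z + (b1 * a2 - b2 * a1) =
      (z - l1) * (z - l2) * (z - l3))
    (h12 : |l2| < |l1|) (h23 : |l3| < |l2|) :
    (∀ p : ℝ × ℝ, IsEquilib a1 b1 a2 b2 p ↔
      p = ((l1 ^ 2 - a2) / b2, l1) ∨ p = ((l2 ^ 2 - a2) / b2, l2) ∨
      p = ((l3 ^ 2 - a2) / b2, l3)) ∧
    (∀ x y : ℕ → ℝ, IsSol a1 b1 a2 b2 x y →
      b2 * x 0 ≠ (b1 - l1) * (y 0 + l1) →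
      Filter.Tendsto (fun n => (x n, y n)) Filter.atTop (𝓝 ((l1 ^ 2 - a2) / b2, l1))) ∧
    (∀ x y : ℕ → ℝ, IsSol a1 b1 a2 b2 x y →
      b2 * x 0 = (b1 - l1) * (y 0 + l1) →
      (x 0, y 0) ≠ ((l3 ^ 2 - a2) / b2, l3) →
      Filter.Tendsto (fun n => (x n, y n)) Filter.atTop
        (𝓝 ((l2 ^ 2 - a2) / b2, l2))) := by
  obtain ⟨hb, ha, hc⟩ := vieta_of_char_eq hfact
  have hprod : l1 * l2 * l3 ≠ 0 := fun h0 => hd (by linear_combination hc + h0)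
  have hl1 : l1 ≠ 0 := by rintro rfl; simp at hprod
  have hl2 : l2 ≠ 0 := by rintro rfl; simp at hprod
  have hl3 : l3 ≠ 0 := by rintro rfl; simp at hprod
  have n12 : l1 ≠ l2 := by rintro rfl; exact h12.false
  have n23 : l2 ≠ l3 := by rintro rfl; exact h23.false
  have n13 : l1 ≠ l3 := by rintro rfl; exact (h12.trans h23).false
  refine ⟨fun p => ?_, fun x y hs h0 => ?_, fun x y hs h0 hne => ?_⟩
  · rw [isEquilib_iff hb2, hfact]
    simp only [Prod.ext_iff, mul_eq_zero, sub_eq_zero]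
    constructor
    · rintro ⟨-, hp, (h | h) | h⟩ <;> simp [hp, h]
    · rintro (⟨hp, h⟩ | ⟨hp, h⟩ | ⟨hp, h⟩) <;> simp [hp, h, hl1, hl2, hl3]
  · refine hs.tendsto_equilib hb2 hfact hl1 n12 n13 n23 (fun h => h0 ?_) (.inr h12)
      (.inr (h23.trans h12))
    unfold eigenForm at h
    linear_combination h
  · have e1 : eigenForm b1 b2 l1 (x 0) (y 0) = 0 := by
      unfold eigenForm
      linear_combination h0
    refine hs.tendsto_equilib hb2 (m := l1) (k := l3) (fun z => by rw [hfact]; ring) hl2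
      n12.symm n23 n13 (fun e2 => hne ?_) (.inl e1) (.inr h23)
    unfold eigenForm at e1 e2
    have hy : y 0 = l3 := mul_left_cancel₀ (sub_ne_zero.2 n12) (by
      linear_combination e1 - e2 + (l1 - l2) * hb)
    rw [Prod.mk.injEq, eq_div_iff hb2]
    refine ⟨?_, hy⟩
    rw [hy] at e1
    linear_combination e1 + (l1 + l3) * hb + ha
end

section
/- Suppose β₂ ≠ 0, α₁β₂ ≠ α₂β₁, and the characteristic polynomial λ³ − β₁λ² − α₂λ + (β₁α₂ − β₂α₁) has a real root λ₁ of multiplicity 3. Then the system has a unique equilibrium, namely ((λ₁² − α₂)/β₂, λ₁), and this equilibrium is a global attractor: every complete solution of the system converges to it. -/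
open Filter Topology

/-- For a nonzero real polynomial, the ratio of consecutive values at the naturals tends to `1`. -/
theorem tendsto_eval_succ_div_eval {P : Polynomial ℝ} (hP : P ≠ 0) :
    Tendsto (fun n : ℕ => P.eval ((n : ℝ) + 1) / P.eval (n : ℝ)) atTop (𝓝 1) := by
  have h := Polynomial.div_tendsto_atTop_leadingCoeff_div_of_degree_eq (Polynomial.taylor 1 P) P
    (Polynomial.degree_taylor P 1)
  rw [Polynomial.leadingCoeff_taylor, div_self (Polynomial.leadingCoeff_ne_zero.mpr hP)] at h
  simpa [Function.comp_def, Polynomial.taylor_eval] using h.comp tendsto_natCast_atTop_atTop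

/-- A sequence whose third differences vanish is given by a polynomial. -/
theorem exists_polynomial_of_third_difference_eq_zero {w : ℕ → ℝ}
    (hw : ∀ n, w (n + 3) = 3 * w (n + 2) - 3 * w (n + 1) + w n) :
    ∃ P : Polynomial ℝ, ∀ n : ℕ, w n = P.eval (n : ℝ) := by
  open Polynomial in
  refine ⟨C (w 0) + C (w 1 - w 0) * X + C ((w 2 - 2 * w 1 + w 0) / 2) * (X * (X - 1)), fun n => ?_⟩
  induction n using Nat.strong_induction_on with
  | _ n ih =>
    match n with
    | 0 => simp
    | 1 => simp
    | 2 => simp; ring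
    | n + 3 =>
      rw [hw, ih n (by lia), ih (n + 1) (by lia), ih (n + 2) (by lia)]
      simp
      ring

/-- Ratios of consecutive terms of a nowhere vanishing solution of the linear recurrence with
characteristic polynomial `(z - l) ^ 3` tend to `l`. -/
theorem tendsto_ratio_of_triple_root {l : ℝ} (hl : l ≠ 0) {z : ℕ → ℝ} (hz0 : z 0 ≠ 0)
    (hz : ∀ n, z (n + 3) = 3 * l * z (n + 2) - 3 * l ^ 2 * z (n + 1) + l ^ 3 * z n) :
    Tendsto (fun n => z (n + 1) / z n) atTop (𝓝 l) := by
  obtain ⟨P, hP⟩ := exists_polynomial_of_third_difference_eq_zero (w := fun n => z n / l ^ n)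
    (fun n => by simp only [hz]; field_simp; ring)
  have hP0 : P ≠ 0 := by
    rintro rfl
    exact hz0 (by simpa using hP 0)
  have h := (tendsto_eval_succ_div_eval hP0).const_mul l
  rw [mul_one] at h
  refine h.congr fun n => ?_
  have h1 := hP (n + 1)
  push_cast at h1
  rw [← h1, ← hP n, pow_succ]
  field_simp

/-- if the characteristic cubic has a real root `λ₁` of multiplicity 3,
then the unique equilibrium is `((λ₁² − α₂)/β₂, λ₁)` and it attracts every complete
solution. -/
theorem stmt14 (a1 b1 a2 b2 : ℝ) (hb2 : b2 ≠ 0) (hd : a1 * b2 ≠ a2 * b1)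
    (l1 : ℝ)
    (hfact : ∀ z : ℝ, z ^ 3 - b1 * z ^ 2 - a2 * z + (b1 * a2 - b2 * a1) = (z - l1) ^ 3) :
    (∀ p : ℝ × ℝ, IsEquilib a1 b1 a2 b2 p ↔ p = ((l1 ^ 2 - a2) / b2, l1)) ∧
    (∀ x y : ℕ → ℝ, IsSol a1 b1 a2 b2 x y →
      Tendsto (fun n => (x n, y n)) atTop (𝓝 ((l1 ^ 2 - a2) / b2, l1))) := by
  have hb1 : b1 = 3 * l1 := by linarith [hfact 0, hfact 1, hfact (-1)]
  have ha2 : a2 = -3 * l1 ^ 2 := by linarith [hfact 0, hfact 1, hfact (-1)]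
  have ha1 : a1 * b2 = -8 * l1 ^ 3 := by
    have h := hfact 0
    rw [hb1, ha2] at h
    linarith
  have hl : l1 ≠ 0 := by
    rintro rfl
    apply hd
    rw [ha1, ha2]
    ring
  refine ⟨?_, ?_⟩
  · rintro ⟨u, v⟩
    simp only [IsEquilib, Prod.mk.injEq]
    constructor
    · rintro ⟨hv, hu1, hv1⟩
      rw [eq_div_iff hv] at hu1 hv1
      have hvl : v = l1 := by
        have h : (v - l1) ^ 3 = 0 := by
          rw [← hfact v]
          linear_combination (v - b1) * hv1 + b2 * hu1
        exact sub_eq_zero.mp (pow_eq_zero_iff (by norm_num) |>.mp h)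
      refine ⟨?_, hvl⟩
      rw [eq_div_iff hb2, ← hvl]
      linarith
    · rintro ⟨rfl, rfl⟩
      refine ⟨hl, ?_, ?_⟩
      · rw [eq_div_iff hl]
        field_simp
        linear_combination hfact v
      · field_simp
        ring
  · rintro x y ⟨hy, hx1, hy1⟩
    have hyy n : y (n + 1) * y n = a2 + b2 * x n := by rw [hy1, div_mul_cancel₀ _ (hy n)]
    have hxy n : x (n + 1) * y n = a1 + b1 * x n := by rw [hx1, div_mul_cancel₀ _ (hy n)]
    have hlim : Tendsto y atTop (𝓝 l1) := by
      have h := tendsto_ratio_of_triple_root hl (z := fun n => ∏ i ∈ Finset.range n, y i)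
        (by simp) (fun n => by
          simp only [Finset.prod_range_succ]
          have h1 := hyy n
          have h2 := hyy (n + 1)
          have h3 := hxy n
          rw [hb1, ha2] at *
          linear_combination (∏ i ∈ Finset.range n, y i) *
            (y n * h2 + b2 * h3 - 3 * l1 * h1 + ha1))
      refine h.congr fun n => ?_
      rw [Finset.prod_range_succ, mul_div_cancel_left₀ _
        (Finset.prod_ne_zero_iff.mpr fun i _ => hy i)]
    have hlim_x : Tendsto x atTop (𝓝 ((l1 ^ 2 - a2) / b2)) := by
      have h := (((hlim.comp (tendsto_add_atTop_nat 1)).mul hlim).sub_const a2).div_const b2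
      rw [← sq] at h
      refine h.congr fun n => ?_
      simp only [Function.comp_apply, hyy]
      field_simp
      ring
    exact hlim_x.prodMk_nhds hlim
end

section
/- Suppose β₂ ≠ 0 and the characteristic polynomial λ³ − β₁λ² − α₂λ + (β₁α₂ − β₂α₁) has a pair of non-real complex roots ρe^{±iθ} with ρ > 0 and sin θ > 0, and a real root λ ≠ 0. Let L be the line {(x, y) ∈ ℝ² : β₂x = (β₁ − λ)(y + λ)}. Then every complete solution whose initial condition lies on L remains on L for all n, and these solutions are all periodic if θ/π is rational and all unbounded if θ/π is irrational. -/
open Filter Topology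

/-- Comparing coefficients in the factorization of the characteristic cubic. -/
lemma coeffs_of_factorization {a1 b1 a2 b2 ρ θ l : ℝ}
    (hfact : ∀ z : ℂ,
      z ^ 3 - (b1 : ℂ) * z ^ 2 - (a2 : ℂ) * z + ((b1 * a2 - b2 * a1 : ℝ) : ℂ) =
        (z - (l : ℂ)) * (z - (ρ : ℂ) * Complex.exp ((θ : ℂ) * Complex.I)) *
          (z - (ρ : ℂ) * Complex.exp (-(θ : ℂ) * Complex.I))) :
    b1 = l + 2 * ρ * Real.cos θ ∧ a2 = -(2 * ρ * Real.cos θ * l + ρ ^ 2) ∧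
      b1 * a2 - b2 * a1 = -(l * ρ ^ 2) := by
  have hreal : ∀ t : ℝ, t ^ 3 - b1 * t ^ 2 - a2 * t + (b1 * a2 - b2 * a1) =
      (t - l) * (t ^ 2 - 2 * ρ * Real.cos θ * t + ρ ^ 2) := by
    intro t
    have h := hfact t
    have hprod : Complex.exp ((θ : ℂ) * Complex.I) * Complex.exp (-(θ : ℂ) * Complex.I) = 1 := by
      rw [← Complex.exp_add]
      simp
    have hsum : Complex.exp ((θ : ℂ) * Complex.I) + Complex.exp (-(θ : ℂ) * Complex.I) =
        2 * Complex.cos θ := (Complex.two_cos θ).symm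
    have hc : (t : ℂ) ^ 3 - b1 * t ^ 2 - a2 * t + ((b1 * a2 - b2 * a1 : ℝ) : ℂ) =
        (t - l) * (t ^ 2 - 2 * ρ * Complex.cos θ * t + ρ ^ 2) := by
      linear_combination h - ((t : ℂ) - l) * t * ρ * hsum + ((t : ℂ) - l) * ρ ^ 2 * hprod
    rw [← Complex.ofReal_cos] at hc
    exact_mod_cast hc
  have h0 := hreal 0
  have h1 := hreal 1
  have h2 := hreal (-1)
  refine ⟨?_, ?_, ?_⟩ <;> linarith

/-- On the invariant line the second coordinate evolves under a Möbius map. -/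
lemma IsSol.mem_line_and_mobius {a1 b1 a2 b2 k d l : ℝ} {x y : ℕ → ℝ}
    (hsol : IsSol a1 b1 a2 b2 x y)
    (hb1 : b1 = l + k) (ha2 : a2 = -(k * l + d)) (hdet : b1 * a2 - b2 * a1 = -(l * d))
    (h0 : b2 * x 0 = (b1 - l) * (y 0 + l)) :
    (∀ n, b2 * x n = (b1 - l) * (y n + l)) ∧ ∀ n, y (n + 1) * y n = k * y n - d := by
  obtain ⟨hy, hx1, hy1⟩ := hsol
  have hX : ∀ n, x (n + 1) * y n = a1 + b1 * x n := fun n => by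
    rw [hx1, div_mul_cancel₀ _ (hy n)]
  have hY : ∀ n, y (n + 1) * y n = a2 + b2 * x n := fun n => by
    rw [hy1, div_mul_cancel₀ _ (hy n)]
  have hline : ∀ n, b2 * x n = (b1 - l) * (y n + l) := by
    intro n
    induction n with
    | zero => exact h0
    | succ n ih =>
      apply mul_right_cancel₀ (hy n)
      subst hb1 ha2
      linear_combination b2 * hX n - k * hY n - hdet + l * ih
  refine ⟨hline, fun n => ?_⟩
  subst hb1 ha2
  linear_combination hY n + hline n

/-- Solutions of `y_{n+1} y_n = 2ρ cos θ y_n - ρ²` are ratios of consecutive terms of a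
trigonometric sequence. -/
lemma exists_mul_trig_eq {ρ θ : ℝ} (hρ : 0 < ρ) (hθ : 0 < Real.sin θ) {y : ℕ → ℝ}
    (hy : ∀ n, y n ≠ 0)
    (hrec : ∀ n, y (n + 1) * y n = 2 * ρ * Real.cos θ * y n - ρ ^ 2) :
    ∃ B : ℝ, ∀ n : ℕ, Real.cos (n * θ) + B * Real.sin (n * θ) ≠ 0 ∧
      y n * (Real.cos (n * θ) + B * Real.sin (n * θ)) =
        ρ * (Real.cos (n * θ + θ) + B * Real.sin (n * θ + θ)) := by
  refine ⟨(y 0 / ρ - Real.cos θ) / Real.sin θ, fun n => ?_⟩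
  set B := (y 0 / ρ - Real.cos θ) / Real.sin θ with hB
  induction n with
  | zero =>
    simp only [Nat.cast_zero, zero_mul, zero_add, Real.cos_zero, Real.sin_zero, mul_zero, add_zero]
    refine ⟨one_ne_zero, ?_⟩
    rw [hB]
    field_simp
    ring
  | succ n ih =>
    obtain ⟨hne, hmul⟩ := ih
    have hcast : ((n + 1 : ℕ) : ℝ) * θ = n * θ + θ := by push_cast; ring
    rw [hcast]
    refine ⟨fun h => ?_, ?_⟩
    · rw [h, mul_zero] at hmul
      exact mul_ne_zero (hy n) hne hmul
    · apply mul_left_cancel₀ hρ.ne'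
      rw [Real.cos_add (n * θ + θ), Real.sin_add (n * θ + θ)]
      have hback : Real.cos (n * θ) + B * Real.sin (n * θ) =
          (Real.cos (n * θ + θ) + B * Real.sin (n * θ + θ)) * Real.cos θ +
          (Real.sin (n * θ + θ) - B * Real.cos (n * θ + θ)) * Real.sin θ := by
        have e := add_sub_cancel_right ((n : ℝ) * θ) θ
        conv_lhs => rw [← e, Real.cos_sub, Real.sin_sub]
        ring
      linear_combination (2 * ρ * Real.cos θ - y (n + 1)) * hmul +
        (Real.cos (n * θ) + B * Real.sin (n * θ)) * hrec n - ρ ^ 2 * hback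

/-- Multiples of an irrational angle bring `cos + B sin` arbitrarily close to zero. -/
lemma exists_nat_abs_trig_lt {θ : ℝ} (hirr : ¬ ∃ q : ℚ, θ = (q : ℝ) * Real.pi) (B : ℝ)
    {ε : ℝ} (hε : 0 < ε) :
    ∃ n : ℕ, |Real.cos (n * θ) + B * Real.sin (n * θ)| < ε := by
  have hI : Irrational (θ / (2 * Real.pi)) := by
    rintro ⟨q, hq⟩
    refine hirr ⟨2 * q, ?_⟩
    have := Real.pi_ne_zero
    push_cast
    rw [hq]
    field_simp
  have : Fact (0 < 2 * Real.pi) := ⟨Real.two_pi_pos⟩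
  have hd : DenseRange (fun n : ℕ => n • (θ : AddCircle (2 * Real.pi))) :=
    denseRange_zsmul_iff_nsmul.1 (AddCircle.denseRange_zsmul_coe_iff.2 hI)
  have hd' : DenseRange (fun n : ℕ => n • (θ : Real.Angle)) := hd
  let f : Real.Angle → ℝ := fun a => |a.cos + B * a.sin|
  have hf : Continuous f :=
    (Real.Angle.continuous_cos.add (continuous_const.mul Real.Angle.continuous_sin)).abs
  have hzero : f ((Real.arctan B + Real.pi / 2 : ℝ) : Real.Angle) = 0 := by
    have ht := Real.tan_mul_cos (Real.cos_arctan_pos B).ne'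
    rw [Real.tan_arctan] at ht
    simp only [f, Real.Angle.cos_coe, Real.Angle.sin_coe, Real.cos_add_pi_div_two,
      Real.sin_add_pi_div_two, ht, neg_add_cancel, abs_zero]
  obtain ⟨n, hn⟩ := hd'.exists_mem_open (isOpen_Iio.preimage hf)
    ⟨_, show f ((Real.arctan B + Real.pi / 2 : ℝ) : Real.Angle) < ε by rw [hzero]; exact hε⟩
  refine ⟨n, ?_⟩
  have hn' : f (n • (θ : Real.Angle)) < ε := hn
  rw [← Real.Angle.coe_nsmul, nsmul_eq_mul] at hn'
  simpa only [f, Real.Angle.cos_coe, Real.Angle.sin_coe] using hn'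

/-- when the characteristic cubic has non-real roots `ρe^{±iθ}`
(`ρ > 0`, `sin θ > 0`) and a real root `λ ≠ 0`, every complete solution starting on the
line `L : β₂x = (β₁ − λ)(y + λ)` remains on `L`, and these solutions are all periodic if
`θ/π` is rational and all unbounded otherwise. -/
theorem stmt16 (a1 b1 a2 b2 : ℝ) (hb2 : b2 ≠ 0)
    (ρ θ l : ℝ) (hρ : 0 < ρ) (hθ : 0 < Real.sin θ) (hl : l ≠ 0)
    (hfact : ∀ z : ℂ,
      z ^ 3 - (b1 : ℂ) * z ^ 2 - (a2 : ℂ) * z + ((b1 * a2 - b2 * a1 : ℝ) : ℂ) =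
        (z - (l : ℂ)) * (z - (ρ : ℂ) * Complex.exp ((θ : ℂ) * Complex.I)) *
          (z - (ρ : ℂ) * Complex.exp (-(θ : ℂ) * Complex.I))) :
    ∀ x y : ℕ → ℝ, IsSol a1 b1 a2 b2 x y →
      b2 * x 0 = (b1 - l) * (y 0 + l) →
      (∀ n, b2 * x n = (b1 - l) * (y n + l)) ∧
      ((∃ q : ℚ, θ = (q : ℝ) * Real.pi) →
        ∃ p : ℕ, 1 ≤ p ∧ ∀ n, x (n + p) = x n ∧ y (n + p) = y n) ∧
      (¬(∃ q : ℚ, θ = (q : ℝ) * Real.pi) → ¬ BoundedSol x y) := by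
  intro x y hsol h0
  obtain ⟨hb1, ha2, hdet⟩ := coeffs_of_factorization hfact
  obtain ⟨hline, hrec⟩ := hsol.mem_line_and_mobius hb1 ha2 hdet h0
  obtain ⟨B, hB⟩ := exists_mul_trig_eq hρ hθ hsol.1 hrec
  refine ⟨hline, ?_, ?_⟩
  · rintro ⟨q, hq⟩
    refine ⟨q.den, q.pos, fun n => ?_⟩
    have hper : ((n + q.den : ℕ) : ℝ) * θ = n * θ + q.num * Real.pi := by
      have hqd : (q : ℝ) * q.den = q.num := by exact_mod_cast q.mul_den_eq_num
      push_cast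
      linear_combination (q.den : ℝ) * hq + Real.pi * hqd
    have hper' : ((n + q.den : ℕ) : ℝ) * θ + θ = (n * θ + θ) + q.num * Real.pi := by
      rw [hper]
      ring
    have hy : y (n + q.den) = y n := by
      obtain ⟨hne, hmul⟩ := hB (n + q.den)
      rw [hper'] at hmul
      rw [hper] at hne hmul
      simp only [Real.cos_add_int_mul_pi, Real.sin_add_int_mul_pi] at hne hmul
      apply mul_right_cancel₀ hne
      linear_combination hmul - (-1) ^ q.num * (hB n).2
    refine ⟨mul_left_cancel₀ hb2 ?_, hy⟩
    rw [hline, hline, hy]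
  · intro hirr hbdd
    obtain ⟨M, hM⟩ := hbdd.exists_norm_le
    have hyM : ∀ n, |y n| ≤ M := fun n =>
      (norm_snd_le (x n, y n)).trans (hM _ ⟨n, rfl⟩)
    have hM0 : 0 ≤ M := (abs_nonneg _).trans (hyM 0)
    have hpos : 0 < ρ * Real.sin θ := mul_pos hρ hθ
    obtain ⟨n, hn⟩ := exists_nat_abs_trig_lt hirr B
      (ε := min (1 / 2) (ρ * Real.sin θ / (2 * (M + ρ + 1)))) (by positivity)
    obtain ⟨hn1, hn2⟩ := lt_min_iff.1 hn
    obtain ⟨-, hmul⟩ := hB n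
    rw [Real.cos_add, Real.sin_add] at hmul
    set c := Real.cos (n * θ)
    set s := Real.sin (n * θ)
    have hcs : s ^ 2 + c ^ 2 = 1 := Real.sin_sq_add_cos_sq _
    have hw : ρ * Real.sin θ * (B * c - s) = (y n - ρ * Real.cos θ) * (c + B * s) := by
      linear_combination -hmul
    have hfac : |y n - ρ * Real.cos θ| ≤ M + ρ := by
      refine (abs_sub _ _).trans (add_le_add (hyM n) ?_)
      rw [abs_mul, abs_of_pos hρ]
      exact mul_le_of_le_one_right hρ.le (Real.abs_cos_le_one θ)
    have hsmall : ρ * Real.sin θ * |B * c - s| < ρ * Real.sin θ * (1 / 2) := by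
      rw [← abs_of_pos hpos, ← abs_mul, abs_of_pos hpos, hw, abs_mul]
      rw [lt_div_iff₀ (by positivity)] at hn2
      nlinarith [mul_le_mul_of_nonneg_right hfac (abs_nonneg (c + B * s)),
        abs_nonneg (c + B * s)]
    have hw1 : |B * c - s| < 1 / 2 := lt_of_mul_lt_mul_left hsmall hpos.le
    have hsq1 := sq_lt_sq' (abs_lt.1 hn1).1 (abs_lt.1 hn1).2
    have hsq2 := sq_lt_sq' (abs_lt.1 hw1).1 (abs_lt.1 hw1).2
    nlinarith [sq_nonneg B]
end

section
/- Suppose β₂ ≠ 0 and the characteristic polynomial λ³ − β₁λ² − α₂λ + (β₁α₂ − β₂α₁) has a pair of non-real complex roots ρe^{±iθ} with ρ > 0 and sin θ > 0, and a real root λ with |λ| > ρ. Let L be the line {(x, y) ∈ ℝ² : β₂x = (β₁ − λ)(y + λ)}. Then the unique equilibrium ((λ² − α₂)/β₂, λ) of the system attracts every complete solution whose initial condition does not lie on L, i.e. every such solution converges to ((λ² − α₂)/β₂, λ). -/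
open Filter Topology

theorem sub_mul_exp_mul_sub_mul_exp_neg (ρ θ t : ℝ) :
    ((t : ℂ) - (ρ : ℂ) * Complex.exp ((θ : ℂ) * Complex.I)) *
        ((t : ℂ) - (ρ : ℂ) * Complex.exp (-(θ : ℂ) * Complex.I)) =
      ((t ^ 2 - 2 * ρ * Real.cos θ * t + ρ ^ 2 : ℝ) : ℂ) := by
  have hmul : Complex.exp ((θ : ℂ) * Complex.I) * Complex.exp (-(θ : ℂ) * Complex.I) = 1 := by
    rw [← Complex.exp_add, neg_mul, add_neg_cancel, Complex.exp_zero]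
  have hadd := Complex.two_cos (θ : ℂ)
  push_cast
  linear_combination (ρ : ℂ) ^ 2 * hmul + (ρ : ℂ) * t * hadd

/-- Solutions of a second order recurrence with non-real characteristic roots of modulus `√r`
are `o(lⁿ)` as soon as `r < l²`. -/
theorem tendsto_div_pow_of_recurrence {c r l : ℝ} {D : ℕ → ℝ}
    (hD : ∀ n, D (n + 2) = c * D (n + 1) - r * D n) (hr : 0 < r) (hc : c ^ 2 < 4 * r)
    (hl : r < l ^ 2) : Tendsto (fun n => D n / l ^ n) atTop (𝓝 0) := by
  have hQ : ∀ n, D (n + 1) ^ 2 - c * D (n + 1) * D n + r * D n ^ 2 =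
      r ^ n * (D 1 ^ 2 - c * D 1 * D 0 + r * D 0 ^ 2) := by
    intro n
    induction n with
    | zero => simp
    | succ k ih =>
      rw [hD k, pow_succ]
      linear_combination r * ih
  set Q := D 1 ^ 2 - c * D 1 * D 0 + r * D 0 ^ 2
  have hδ : 0 < r - c ^ 2 / 4 := by linarith
  have hl2 : 0 < l ^ 2 := hr.trans hl
  have hbound : ∀ n, (D n / l ^ n) ^ 2 ≤ Q / (r - c ^ 2 / 4) * (r / l ^ 2) ^ n := by
    intro n
    have h : D n ^ 2 ≤ Q / (r - c ^ 2 / 4) * r ^ n := by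
      rw [div_mul_eq_mul_div, le_div_iff₀ hδ]
      nlinarith [hQ n, sq_nonneg (D (n + 1) - c / 2 * D n)]
    rw [div_pow, div_pow, ← pow_mul, mul_comm n 2, pow_mul, ← mul_div_assoc]
    gcongr
  have hgeom : Tendsto (fun n : ℕ => Q / (r - c ^ 2 / 4) * (r / l ^ 2) ^ n) atTop (𝓝 0) := by
    simpa using (tendsto_pow_atTop_nhds_zero_of_lt_one (by positivity)
      ((div_lt_one hl2).2 hl)).const_mul (Q / (r - c ^ 2 / 4))
  have hsq := squeeze_zero (fun n => sq_nonneg (D n / l ^ n)) hbound hgeom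
  rw [tendsto_zero_iff_abs_tendsto_zero]
  simpa [Function.comp_def, Real.sqrt_sq_eq_abs] using (Real.continuous_sqrt.tendsto 0).comp hsq

/-- Ratios of consecutive terms of a solution of a third order recurrence with a dominant real
characteristic root `l` converge to `l`, provided the solution has a component along `lⁿ`. -/
theorem tendsto_ratio_of_recurrence {c r l : ℝ} {W : ℕ → ℝ}
    (hW : ∀ n, W (n + 3) - c * W (n + 2) + r * W (n + 1) =
      l * (W (n + 2) - c * W (n + 1) + r * W n))
    (hr : 0 < r) (hc : c ^ 2 < 4 * r) (hl : r < l ^ 2) (h0 : W 2 - c * W 1 + r * W 0 ≠ 0) :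
    Tendsto (fun n => W (n + 1) / W n) atTop (𝓝 l) := by
  have hl0 : l ≠ 0 := by
    rintro rfl
    nlinarith
  have hV : ∀ n, W (n + 2) - c * W (n + 1) + r * W n = l ^ n * (W 2 - c * W 1 + r * W 0) := by
    intro n
    induction n with
    | zero => simp
    | succ k ih =>
      rw [pow_succ]
      linear_combination hW k + l * ih
  have hq : 0 < l ^ 2 - c * l + r := by nlinarith [sq_nonneg (l - c / 2)]
  set V := W 2 - c * W 1 + r * W 0
  set K := V / (l ^ 2 - c * l + r)
  have hKq : K * (l ^ 2 - c * l + r) = V := div_mul_cancel₀ _ hq.ne'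
  have hK0 : K ≠ 0 := div_ne_zero h0 hq.ne'
  have hD := tendsto_div_pow_of_recurrence (D := fun n => W n - K * l ^ n) (c := c) (r := r)
    (l := l) (fun n => by
      simp only [pow_succ]
      linear_combination hV n - l ^ n * hKq) hr hc hl
  have hWl : Tendsto (fun n => W n / l ^ n) atTop (𝓝 K) := by
    have h := hD.add_const K
    rw [zero_add] at h
    refine h.congr fun n => ?_
    have := pow_ne_zero n hl0
    field_simp
    ring
  have hlim := (((tendsto_add_atTop_iff_nat 1).2 hWl).div hWl hK0).const_mul l
  rw [div_self hK0, mul_one] at hlim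
  refine hlim.congr fun n => ?_
  have := pow_ne_zero n hl0
  simp only [Pi.div_apply, pow_succ]
  field_simp

/-- when the characteristic cubic has non-real roots `ρe^{±iθ}`
(`ρ > 0`, `sin θ > 0`) and a real root `λ` with `|λ| > ρ`, the unique equilibrium
`((λ² − α₂)/β₂, λ)` attracts every complete solution not starting on the line
`L : β₂x = (β₁ − λ)(y + λ)`. -/
theorem stmt17 (a1 b1 a2 b2 : ℝ) (hb2 : b2 ≠ 0)
    (ρ θ l : ℝ) (hρ : 0 < ρ) (hθ : 0 < Real.sin θ) (hgt : ρ < |l|)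
    (hfact : ∀ z : ℂ,
      z ^ 3 - (b1 : ℂ) * z ^ 2 - (a2 : ℂ) * z + ((b1 * a2 - b2 * a1 : ℝ) : ℂ) =
        (z - (l : ℂ)) * (z - (ρ : ℂ) * Complex.exp ((θ : ℂ) * Complex.I)) *
          (z - (ρ : ℂ) * Complex.exp (-(θ : ℂ) * Complex.I))) :
    (∀ p : ℝ × ℝ, IsEquilib a1 b1 a2 b2 p ↔ p = ((l ^ 2 - a2) / b2, l)) ∧
    (∀ x y : ℕ → ℝ, IsSol a1 b1 a2 b2 x y →
      b2 * x 0 ≠ (b1 - l) * (y 0 + l) →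
      Tendsto (fun n => (x n, y n)) atTop (𝓝 ((l ^ 2 - a2) / b2, l))) := by
  set c := 2 * ρ * Real.cos θ with hcdef
  have hreal : ∀ t : ℝ, t ^ 3 - b1 * t ^ 2 - a2 * t + (b1 * a2 - b2 * a1) =
      (t - l) * (t ^ 2 - c * t + ρ ^ 2) := by
    intro t
    have h := hfact t
    rw [mul_assoc, sub_mul_exp_mul_sub_mul_exp_neg] at h
    exact_mod_cast h
  have h0 := hreal 0
  have h1 := hreal 1
  have h2 := hreal (-1)
  have hb1 : b1 = l + c := by linarith
  have ha2 : a2 = -(ρ ^ 2 + l * c) := by linarith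
  have hdet : b1 * a2 - b2 * a1 = -(l * ρ ^ 2) := by linarith
  have hr : 0 < ρ ^ 2 := by positivity
  have hc : c ^ 2 < 4 * ρ ^ 2 := by
    have : 0 < ρ ^ 2 * Real.sin θ ^ 2 := by positivity
    rw [hcdef]
    nlinarith [Real.sin_sq_add_cos_sq θ]
  have hl : ρ ^ 2 < l ^ 2 := by
    rw [← sq_abs l]
    gcongr
  have hl0 : l ≠ 0 := by
    rintro rfl
    nlinarith
  refine ⟨?_, ?_⟩
  · rintro ⟨p, q⟩
    simp only [IsEquilib, Prod.mk.injEq]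
    constructor
    · rintro ⟨hq, hp, hqq⟩
      rw [eq_div_iff hq] at hp hqq
      have hroot : (q - l) * (q ^ 2 - c * q + ρ ^ 2) = 0 := by
        rw [← hreal q]
        linear_combination (q - b1) * hqq + b2 * hp
      have hpos : 0 < q ^ 2 - c * q + ρ ^ 2 := by nlinarith [sq_nonneg (q - c / 2)]
      obtain rfl : q = l := by
        rcases mul_eq_zero.1 hroot with h | h
        · linarith
        · exact absurd h hpos.ne'
      refine ⟨?_, rfl⟩
      rw [eq_div_iff hb2]
      linear_combination -hqq
    · rintro ⟨rfl, rfl⟩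
      have hroot := hreal q
      refine ⟨hl0, ?_, ?_⟩
      · field_simp
        linear_combination hroot
      · field_simp
        ring
  · rintro x y ⟨hy, hx1, hy1⟩ hL
    have hx1 : ∀ n, x (n + 1) * y n = a1 + b1 * x n := fun n => by
      rw [hx1, div_mul_cancel₀ _ (hy n)]
    have hy1 : ∀ n, y (n + 1) * y n = a2 + b2 * x n := fun n => by
      rw [hy1, div_mul_cancel₀ _ (hy n)]
    have hW0 : ∀ n, ∏ i ∈ Finset.range n, y i ≠ 0 := fun n =>
      Finset.prod_ne_zero_iff.2 fun i _ => hy i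
    have hylim : Tendsto y atTop (𝓝 l) := by
      refine (tendsto_ratio_of_recurrence (W := fun n => ∏ i ∈ Finset.range n, y i) (c := c)
        (fun n => ?_) hr hc hl ?_).congr fun n => ?_
      · simp only [Finset.prod_range_succ]
        have key : y (n + 2) * y (n + 1) * y n =
            b1 * (y (n + 1) * y n) + a2 * y n - (b1 * a2 - b2 * a1) := by
          linear_combination y n * hy1 (n + 1) + b2 * hx1 n - b1 * hy1 n
        rw [hdet, hb1, ha2] at key
        linear_combination (∏ i ∈ Finset.range n, y i) * key
      · simp only [Finset.prod_range_succ, Finset.prod_range_zero]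
        intro h
        apply hL
        rw [hb1]
        linear_combination h - hy1 0 - ha2
      · rw [Finset.prod_range_succ, mul_div_cancel_left₀ _ (hW0 n)]
    refine Tendsto.prodMk_nhds ?_ hylim
    have hlim := ((((tendsto_add_atTop_iff_nat 1).2 hylim).mul hylim).sub_const a2).div_const b2
    rw [← sq] at hlim
    refine hlim.congr fun n => ?_
    rw [hy1, add_sub_cancel_left, mul_div_cancel_left₀ _ hb2]
end
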